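/- arXiv:1810.09323 — 3 statements merged into one kernel-verified Lean document; each statement's English description precedes it below -/
import Mathlib

section
/- If a connected finite simple graph G contains, for some k ∈ ℕ, a circuit through any 2k−1 prescribed edges, then G contains a circuit through any 2k prescribed edges. -/
open SimpleGraph

/-- `G` has a circuit (closed walk repeating no edges) through all edges of `S`. -/
def CircuitThrough {V : Type*} (G : SimpleGraph V) (S : Set (Sym2 V)) : Prop :=
  ∃ (x : V) (c : G.Walk x x), c.IsCircuit ∧ ∀ e ∈ S, e ∈ c.edges

namespace CircP

/-- A pair of disjoint independent subsets of `N`. -/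
def Good {K W E : Type*} [Field K] [AddCommGroup W] [Module K W]
    (x : Bool → E → W) (N : Finset E) (I : Bool → Finset E) : Prop :=
  (∀ i, I i ⊆ N) ∧ Disjoint (I true) (I false) ∧ ∀ i, LinearIndepOn K (x i) (I i : Set E)

/-- One exchange step. -/
def Step {K W E : Type*} [Field K] [AddCommGroup W] [Module K W] [DecidableEq E]
    (x : Bool → E → W) (N : Finset E) (I J : Bool → Finset E) : Prop :=
  ∃ i e y, e ∈ N ∧ (∀ j, e ∉ I j) ∧ y ∈ I i ∧
    J = Function.update I i (insert e ((I i).erase y)) ∧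
    LinearIndepOn K (x i) (insert e ((I i).erase y) : Finset E)

theorem exchange {K W E : Type*} [Field K] [AddCommGroup W] [Module K W] [DecidableEq E]
    (x : E → W) (I : Finset E) (hI : LinearIndepOn K x (I : Set E)) (e : E) (he : e ∉ I)
    (hs : x e ∈ Submodule.span K (x '' (I : Set E))) :
    x e ∈ Submodule.span K (x '' {y | y ∈ I ∧
      LinearIndepOn K x ((insert e (I.erase y) : Finset E) : Set E)}) := by
  classical
  obtain ⟨l, hl, hle⟩ := (Finsupp.mem_span_image_iff_linearCombination K).1 hs
  refine (Finsupp.mem_span_image_iff_linearCombination K).2 ⟨l, ?_, hle⟩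
  rw [Finsupp.mem_supported] at hl ⊢
  intro y hy
  have hyI : y ∈ I := by simpa using hl hy
  refine ⟨hyI, ?_⟩
  rw [Finset.coe_insert, linearIndepOn_insert (by simp [he])]
  have hsub : ((I.erase y : Finset E) : Set E) ⊆ (I : Set E) := by
    intro z hz; simp at hz; simpa using hz.1
  refine ⟨hI.mono hsub, fun hmem => ?_⟩
  have hny := hI.notMem_span (i := y) (by simpa using hyI)
  apply hny
  have hset : ((I : Set E) \ {y}) = ((I.erase y : Finset E) : Set E) := by
    ext z; simp
  rw [hset]
  have hly : l y ≠ 0 := by simpa using hy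
  have h1 : x e = l y • x y + Finsupp.linearCombination K x (l.erase y) := by
    rw [← hle]
    conv_lhs => rw [← Finsupp.single_add_erase y l]
    simp
  have h2 : Finsupp.linearCombination K x (l.erase y) ∈
      Submodule.span K (x '' ((I.erase y : Finset E) : Set E)) := by
    refine (Finsupp.mem_span_image_iff_linearCombination K).2 ⟨_, ?_, rfl⟩
    rw [Finsupp.mem_supported]
    intro z hz
    simp at hz
    have := hl (show z ∈ (l.support : Set E) by simpa using hz.1)
    simp only [Finset.coe_erase, Set.mem_sdiff, Set.mem_singleton_iff]
    exact ⟨this, hz.2⟩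
  have h3 : x y = (l y)⁻¹ • (x e - Finsupp.linearCombination K x (l.erase y)) := by
    rw [h1]; simp [smul_smul, inv_mul_cancel₀ hly]
  rw [h3]
  exact Submodule.smul_mem _ _ (Submodule.sub_mem _ hmem h2)

theorem packing {K W E : Type*} [Field K] [AddCommGroup W] [Module K W] [Fintype E]
    [DecidableEq E] (x : Bool → E → W) (N : Finset E) :
    ∃ (I : Bool → Finset E) (Q : Finset E), Good (K := K) x N I ∧ Q ⊆ N ∧
      (∀ e ∈ N, e ∉ Q → ∃ i, e ∈ I i) ∧
      ∀ i, ∀ q ∈ Q, x i q ∈ Submodule.span K (x i '' ((I i ∩ Q : Finset E) : Set E)) := by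
  classical
  obtain ⟨I0, hI0, hmax⟩ := Finset.exists_max_image
    (Finset.univ.filter fun I : Bool → Finset E => Good (K := K) x N I)
    (fun I => (I true).card + (I false).card)
    ⟨fun _ => ∅, by simp [Good, linearIndepOn_empty]⟩
  simp only [Finset.mem_filter, Finset.mem_univ, true_and] at hI0 hmax
  let R := Relation.ReflTransGen (Step (K := K) x N) I0
  have hR : ∀ I, R I → Good (K := K) x N I ∧
      (I true).card + (I false).card = (I0 true).card + (I0 false).card := by
    intro I h
    induction h with
    | refl => exact ⟨hI0, rfl⟩
    | tail _ hs ih =>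
      rename_i J J' _
      obtain ⟨i, e, y, heN, he, hy, rfl, hind⟩ := hs
      obtain ⟨⟨g1, g2, g3⟩, hc⟩ := ih
      have hcard : (insert e ((J i).erase y)).card = (J i).card := by
        rw [Finset.card_insert_of_notMem (by simp [he i]), Finset.card_erase_of_mem hy]
        have := Finset.card_pos.2 ⟨y, hy⟩
        omega
      have hsub : insert e ((J i).erase y) ⊆ N := by
        intro z hz
        simp only [Finset.mem_insert, Finset.mem_erase] at hz
        rcases hz with rfl | hz
        · exact heN
        · exact g1 i hz.2
      have hdis : ∀ j, j ≠ i → Disjoint (insert e ((J i).erase y)) (J j) := by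
        intro j hj
        rw [Finset.disjoint_left]
        intro z hz hzj
        simp only [Finset.mem_insert, Finset.mem_erase] at hz
        rcases hz with rfl | hz
        · exact he j hzj
        · rw [Finset.disjoint_left] at g2
          cases i <;> cases j <;> simp_all
      refine ⟨⟨?_, ?_, ?_⟩, ?_⟩
      · intro j
        by_cases hj : j = i
        · subst hj; simpa using hsub
        · simpa [Function.update_of_ne hj] using g1 j
      · cases i
        · simpa using (hdis true (by simp)).symm
        · simpa using hdis false (by simp)
      · intro j
        by_cases hj : j = i
        · subst hj; simpa using hind
        · simpa [Function.update_of_ne hj] using g3 j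
      · rw [← hc]
        cases i <;> simp [hcard]
  let Q : Finset E := N.filter fun q => ∃ I, R I ∧ ∀ j, q ∉ I j
  have key : ∀ I, R I → ∀ e ∈ N, (∀ j, e ∉ I j) → ∀ i,
      x i e ∈ Submodule.span K (x i '' ((I i ∩ Q : Finset E) : Set E)) := by
    intro I hI e heN he i
    obtain ⟨⟨g1, g2, g3⟩, hc⟩ := hR I hI
    have hsp : x i e ∈ Submodule.span K (x i '' (I i : Set E)) := by
      by_contra hcon
      have hind := (g3 i).insert hcon
      have hg : Good (K := K) x N (Function.update I i (insert e (I i))) := by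
        refine ⟨?_, ?_, ?_⟩
        · intro j
          by_cases hj : j = i
          · subst hj
            simpa [Finset.insert_subset_iff] using ⟨heN, g1 j⟩
          · simpa [Function.update_of_ne hj] using g1 j
        · cases i
          · simpa [Finset.disjoint_insert_right] using ⟨he true, g2⟩
          · simpa [Finset.disjoint_insert_left] using ⟨he false, g2⟩
        · intro j
          by_cases hj : j = i
          · subst hj; simpa using hind
          · simpa [Function.update_of_ne hj] using g3 j
      have := hmax _ hg
      cases i <;> simp [Finset.card_insert_of_notMem, he] at this <;> omega
    refine Submodule.span_mono ?_ (exchange (x i) (I i) (g3 i) e (he i) hsp)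
    apply Set.image_mono
    rintro y ⟨hy, hyind⟩
    simp only [Finset.coe_inter, Set.mem_inter_iff, Finset.mem_coe]
    refine ⟨hy, ?_⟩
    simp only [Q, Finset.mem_filter]
    refine ⟨g1 i hy, Function.update I i (insert e ((I i).erase y)),
      hI.tail ⟨i, e, y, heN, he, hy, rfl, hyind⟩, ?_⟩
    intro j
    have hye : y ≠ e := fun h => he i (h ▸ hy)
    by_cases hj : j = i
    · subst hj; simp [hye]
    · rw [Function.update_of_ne hj]
      rw [Finset.disjoint_left] at g2
      intro hyj
      cases i <;> cases j <;> simp_all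
  have inv : ∀ I, R I → ∀ i, Submodule.span K (x i '' ((I i ∩ Q : Finset E) : Set E)) =
      Submodule.span K (x i '' ((I0 i ∩ Q : Finset E) : Set E)) := by
    intro I h
    induction h with
    | refl => intro i; rfl
    | tail hprev hs ih =>
      rename_i J J'
      intro k
      rw [← ih k]
      have hJ' : R J' := Relation.ReflTransGen.tail hprev hs
      obtain ⟨i, e, y, heN, he, hy, rfl, hind⟩ := hs
      have hye : y ≠ e := fun h => he i (h ▸ hy)
      by_cases hk : k = i
      · subst hk
        obtain ⟨⟨g1, g2, g3⟩, hc⟩ := hR J hprev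
        have hyu : ∀ j, y ∉ Function.update J k (insert e ((J k).erase y)) j := by
          intro j
          by_cases hj : j = k
          · subst hj; simp [hye]
          · rw [Function.update_of_ne hj]
            rw [Finset.disjoint_left] at g2
            intro hyj
            cases k <;> cases j <;> simp_all
        have k1 := key J hprev e heN he k
        have k2 := key _ hJ' y (g1 k hy) hyu k
        apply le_antisymm
        · rw [Submodule.span_le]
          rintro _ ⟨z, hz, rfl⟩
          simp at hz
          rcases hz with ⟨rfl | hz, hzQ⟩
          · exact k1
          · exact Submodule.subset_span ⟨z, by simp [hz, hzQ], rfl⟩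
        · rw [Submodule.span_le]
          rintro _ ⟨z, hz, rfl⟩
          simp at hz
          by_cases hzy : z = y
          · subst hzy; exact k2
          · exact Submodule.subset_span ⟨z, by simp [hz, hzy], rfl⟩
      · rw [Function.update_of_ne hk]
  refine ⟨I0, Q, hI0, Finset.filter_subset _ _, ?_, ?_⟩
  · intro e heN heQ
    by_contra hcon
    push Not at hcon
    exact heQ (by simp only [Q, Finset.mem_filter]; exact ⟨heN, I0, .refl, hcon⟩)
  · intro i q hq
    simp only [Q, Finset.mem_filter] at hq
    obtain ⟨hqN, I, hI, hqI⟩ := hq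
    rw [← inv I hI i]
    exact key I hI q hqN hqI i

end CircP

namespace CircP

section defs
variable {V E : Type*}

/-- Coboundary of a vertex labelling along an edge. -/
def dd (a b : E → V) (χ : V → ZMod 2) (e : E) : ZMod 2 := χ (a e) + χ (b e)

/-- All cuts of `F` are even. -/
def EvenF (a b : E → V) (F : Finset E) : Prop := ∀ χ, ∑ e ∈ F, dd a b χ e = 0

/-- `F` is connected up to isolated vertices. -/
def ConnF (a b : E → V) (F : Finset E) : Prop :=
  ∀ χ, (∀ e ∈ F, dd a b χ e = 0) → ∃ c, ∀ e ∈ F, χ (a e) = c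

/-- `F` is connected and spanning. -/
def Spans (a b : E → V) (F : Finset E) : Prop :=
  ∀ χ, (∀ e ∈ F, dd a b χ e = 0) → ∃ c, ∀ v, χ v = c

open Classical in
/-- Edges across a cut. -/
noncomputable def cutF [Fintype E] (a b : E → V) (χ : V → ZMod 2) : Finset E :=
  Finset.univ.filter fun e => dd a b χ e ≠ 0

/-- No odd cut of size at most `m`. -/
def NoOdd [Fintype E] (a b : E → V) (m : ℕ) : Prop :=
  ∀ χ, Odd (cutF a b χ).card → m < (cutF a b χ).card

theorem z2 (x : ZMod 2) : x = 0 ∨ x = 1 := by revert x; decide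
theorem z2add (x : ZMod 2) : x + x = 0 := by revert x; decide
theorem z2eq {x y : ZMod 2} : x + y = 0 ↔ x = y := by revert x y; decide
theorem z2ne {x : ZMod 2} : x ≠ 0 ↔ x = 1 := by revert x; decide

theorem dd_add (a b : E → V) (χ ψ : V → ZMod 2) (e : E) :
    dd a b (fun v => χ v + ψ v) e = dd a b χ e + dd a b ψ e := by
  simp only [dd]; ring

theorem mem_cutF [Fintype E] (a b : E → V) (χ : V → ZMod 2) (e : E) :
    e ∈ cutF a b χ ↔ dd a b χ e ≠ 0 := by simp [cutF]

theorem sum_eq_card (a b : E → V) (χ : V → ZMod 2) (F : Finset E)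
    [DecidablePred fun e => dd a b χ e ≠ 0] :
    ∑ e ∈ F, dd a b χ e = ((F.filter fun e => dd a b χ e ≠ 0).card : ZMod 2) := by
  rw [Finset.card_filter]
  push_cast
  apply Finset.sum_congr rfl
  intro e _
  rcases z2 (dd a b χ e) with h | h <;> simp [h]

theorem sum_univ_eq_card [Fintype E] (a b : E → V) (χ : V → ZMod 2) :
    ∑ e, dd a b χ e = ((cutF a b χ).card : ZMod 2) := by
  classical
  rw [sum_eq_card]
  congr

theorem odd_iff_cast (n : ℕ) : Odd n ↔ (n : ZMod 2) ≠ 0 := by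
  rw [Ne, ZMod.natCast_eq_zero_iff, ← even_iff_two_dvd, Nat.not_even_iff_odd]

theorem Spans.conn {a b : E → V} {F : Finset E} (h : Spans a b F) : ConnF a b F := by
  intro χ hχ
  obtain ⟨c, hc⟩ := h χ hχ
  exact ⟨c, fun e _ => hc _⟩

theorem Spans.mono {a b : E → V} {F F' : Finset E} (h : Spans a b F) (hs : F ⊆ F') :
    Spans a b F' := fun χ hχ => h χ fun e he => hχ e (hs he)

/-- `T`-joins. -/
theorem tjoin [DecidableEq E] (a b : E → V) (B : Finset E) : ∀ (A : Finset E), Disjoint A B →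
    (∀ χ, (∀ e ∈ B, dd a b χ e = 0) → ∑ e ∈ A, dd a b χ e = 0) →
    ∃ J ⊆ B, EvenF a b (A ∪ J) := by
  induction B using Finset.induction_on with
  | empty =>
    intro A _ h
    exact ⟨∅, by simp, fun χ => by simpa using h χ (by simp)⟩
  | insert e B he ih =>
    intro A hA h
    rw [Finset.disjoint_insert_right] at hA
    by_cases hc : ∀ χ, (∀ e ∈ B, dd a b χ e = 0) → ∑ e ∈ A, dd a b χ e = 0
    · obtain ⟨J, hJ, hJ'⟩ := ih A hA.2 hc
      exact ⟨J, hJ.trans (Finset.subset_insert _ _), hJ'⟩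
    · push Not at hc
      obtain ⟨χ, hχ, hs⟩ := hc
      have hχe : dd a b χ e ≠ 0 := by
        intro h0
        apply hs
        apply h
        intro f hf
        rcases Finset.mem_insert.1 hf with rfl | hf
        · exact h0
        · exact hχ f hf
      obtain ⟨J, hJ, hJ'⟩ := ih (insert e A)
        (by rw [Finset.disjoint_insert_left]; exact ⟨he, hA.2⟩) (by
          intro ψ hψ
          rw [Finset.sum_insert hA.1]
          by_cases hψe : dd a b ψ e = 0
          · rw [hψe, zero_add]
            apply h
            intro f hf
            rcases Finset.mem_insert.1 hf with rfl | hf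
            · exact hψe
            · exact hψ f hf
          · have h1 := h (fun v => χ v + ψ v) (by
              intro f hf
              rw [dd_add]
              rcases Finset.mem_insert.1 hf with rfl | hf
              · rw [z2ne.1 hχe, z2ne.1 hψe]; decide
              · rw [hχ f hf, hψ f hf]; decide)
            simp only [dd_add, Finset.sum_add_distrib] at h1
            rw [z2ne.1 hs] at h1
            rw [z2ne.1 hψe]
            exact h1)
      refine ⟨insert e J, Finset.insert_subset_insert _ hJ, ?_⟩
      have : A ∪ insert e J = insert e A ∪ J := by ext; simp
      rw [this]; exact hJ'

end defs

section main4
set_option linter.unusedSectionVars false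
variable {V E : Type*} [Fintype V] [DecidableEq V] [Fintype E] [DecidableEq E]

/-- Incidence vector of an edge. -/
def xv (a b : E → V) (e : E) : V → ZMod 2 := Pi.single (a e) 1 + Pi.single (b e) 1

/-- Pairing with a labelling. -/
def pair (χ : V → ZMod 2) : (V → ZMod 2) →ₗ[ZMod 2] ZMod 2 where
  toFun w := ∑ v, χ v * w v
  map_add' x y := by simp [mul_add, Finset.sum_add_distrib]
  map_smul' c x := by
    simp only [Pi.smul_apply, smul_eq_mul, RingHom.id_apply, Finset.mul_sum]
    apply Finset.sum_congr rfl; intro v _; ring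

theorem pair_single (χ : V → ZMod 2) (v : V) : pair χ (Pi.single v 1) = χ v := by
  simp [pair, Pi.single_apply]

theorem pair_xv (a b : E → V) (χ : V → ZMod 2) (e : E) : pair χ (xv a b e) = dd a b χ e := by
  simp [xv, dd, pair_single]

/-- Span of the incidence vectors. -/
def U (a b : E → V) (A : Finset E) : Submodule (ZMod 2) (V → ZMod 2) :=
  Submodule.span (ZMod 2) (xv a b '' (A : Set E))

theorem pair_zero_of_mem (a b : E → V) (A : Finset E) (χ : V → ZMod 2)
    (h : ∀ e ∈ A, dd a b χ e = 0) {w : V → ZMod 2} (hw : w ∈ U a b A) : pair χ w = 0 := by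
  have : U a b A ≤ LinearMap.ker (pair χ) := by
    rw [U, Submodule.span_le]
    rintro _ ⟨e, he, rfl⟩
    simpa [pair_xv] using h e he
  exact this hw

theorem dd_zero_of_mem (a b : E → V) (A : Finset E) (χ : V → ZMod 2)
    (h : ∀ e ∈ A, dd a b χ e = 0) {e : E} (hw : xv a b e ∈ U a b A) : dd a b χ e = 0 := by
  rw [← pair_xv]; exact pair_zero_of_mem a b A χ h hw

theorem U_mono (a b : E → V) {A B : Finset E} (h : A ⊆ B) : U a b A ≤ U a b B :=
  Submodule.span_mono (Set.image_mono (by exact_mod_cast h))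

theorem U_union (a b : E → V) (A B : Finset E) : U a b (A ∪ B) = U a b A ⊔ U a b B := by
  rw [U, Finset.coe_union, Set.image_union, Submodule.span_union]; rfl

theorem mem_U (a b : E → V) {A : Finset E} {e : E} (h : e ∈ A) : xv a b e ∈ U a b A :=
  Submodule.subset_span ⟨e, by exact_mod_cast h, rfl⟩

theorem finrank_U_lt [Nonempty V] (a b : E → V) (A : Finset E) :
    Module.finrank (ZMod 2) (U a b A) + 1 ≤ Fintype.card V := by
  have h : U a b A ≠ ⊤ := by
    intro h
    obtain ⟨v⟩ := ‹Nonempty V›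
    have h1 : (Pi.single v 1 : V → ZMod 2) ∈ U a b A := by rw [h]; trivial
    have := pair_zero_of_mem a b A (fun _ => 1) (fun e _ => by simp [dd]; decide) h1
    rw [pair_single] at this
    exact one_ne_zero this
  have := Submodule.finrank_lt h
  simp at this
  omega


theorem part_count (a b : E → V) (m : ℕ) (hm : 3 ≤ m)
    (h4 : ∀ χ : V → ZMod 2, (∃ v w, χ v ≠ χ w) → 4 ≤ (cutF a b χ).card)
    (hno : NoOdd a b m) (s : Setoid V) [Fintype (Quotient s)] [DecidableEq (Quotient s)] :
    (∀ χ : V → ZMod 2, (∀ v w, s v w → χ v = χ w) → ∑ e, dd a b χ e = 0) ∨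
    2 * Fintype.card (Quotient s) + m ≤
      (Finset.univ.filter fun e => (⟦a e⟧ : Quotient s) ≠ ⟦b e⟧).card + 3 := by
  classical
  let χ : Quotient s → V → ZMod 2 := fun c v => if (⟦v⟧ : Quotient s) = c then 1 else 0
  by_cases hall : ∀ c, ∑ e, dd a b (χ c) e = 0
  · left
    intro ψ hψ
    have hψ' : ∀ v, ψ v = ∑ c, (Quotient.lift ψ hψ c) * χ c v := by
      intro v
      simp [χ]
    have : ∀ e, dd a b ψ e = ∑ c, (Quotient.lift ψ hψ c) * dd a b (χ c) e := by
      intro e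
      simp only [dd, mul_add, Finset.sum_add_distrib]
      rw [← hψ', ← hψ']
    simp only [this]
    rw [Finset.sum_comm]
    simp only [← Finset.mul_sum, hall, mul_zero, Finset.sum_const_zero]
  · right
    push Not at hall
    obtain ⟨c0, hc0⟩ := hall
    have hsum : ∑ c, (cutF a b (χ c)).card =
        2 * (Finset.univ.filter fun e => (⟦a e⟧ : Quotient s) ≠ ⟦b e⟧).card := by
      simp only [cutF, Finset.card_filter]
      rw [Finset.sum_comm, Finset.mul_sum]
      apply Finset.sum_congr rfl
      intro e _
      by_cases h : (⟦a e⟧ : Quotient s) = ⟦b e⟧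
      · simp only [dd, χ, h, z2add]
        simp
      · rw [if_pos h, ← Finset.card_filter]
        have : (Finset.univ.filter fun c => dd a b (χ c) e ≠ 0) = {⟦a e⟧, ⟦b e⟧} := by
          ext c
          rw [Finset.mem_filter]
          simp only [Finset.mem_univ, true_and, Finset.mem_insert,
            Finset.mem_singleton, dd, χ]
          by_cases h1 : (⟦a e⟧ : Quotient s) = c
          · have h2 : ¬ (⟦b e⟧ : Quotient s) = c := fun h2 => h (h1.trans h2.symm)
            simp [h1, h2]
          · by_cases h2 : (⟦b e⟧ : Quotient s) = c
            · simp [h1, h2]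
            · have h1' : ¬ c = (⟦a e⟧ : Quotient s) := fun h => h1 h.symm
              have h2' : ¬ c = (⟦b e⟧ : Quotient s) := fun h => h2 h.symm
              simp [h1, h2, h1', h2']
        rw [this, Finset.card_pair h, mul_one]
    have hc1 : ∃ c1, c1 ≠ c0 ∧ ∑ e, dd a b (χ c1) e ≠ 0 := by
      by_contra hcon
      push Not at hcon
      have h1 : ∑ c, ∑ e, dd a b (χ c) e = ∑ e, dd a b (χ c0) e :=
        Finset.sum_eq_single c0 (fun c _ hc => hcon c hc) (by simp)
      have h2 : ∑ c, ∑ e, dd a b (χ c) e = 0 := by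
        simp only [sum_univ_eq_card]
        rw [← Nat.cast_sum, hsum]
        push_cast
        have : (2 : ZMod 2) = 0 := by decide
        rw [this, zero_mul]
      exact hc0 (h1.symm.trans h2)
    obtain ⟨c1, hne, hc1⟩ := hc1
    have hnc : ∀ c, ∃ v w, χ c v ≠ χ c w := by
      intro c
      obtain ⟨v, hv⟩ := Quotient.exists_rep c
      have : ∃ d, d ≠ c := by
        by_cases h : c = c0
        · exact ⟨c1, h ▸ hne⟩
        · exact ⟨c0, fun h' => h h'.symm⟩
      obtain ⟨d, hd⟩ := this
      obtain ⟨w, hw⟩ := Quotient.exists_rep d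
      refine ⟨v, w, ?_⟩
      simp [χ, hv, hw, hd]
    have hodd : ∀ c, ∑ e, dd a b (χ c) e ≠ 0 → m < (cutF a b (χ c)).card := by
      intro c hc
      rw [sum_univ_eq_card, ← odd_iff_cast] at hc
      exact hno _ hc
    have hlow : ∀ c, 4 + (if c = c0 then m - 3 else 0) + (if c = c1 then m - 3 else 0) ≤
        (cutF a b (χ c)).card := by
      intro c
      by_cases h0 : c = c0
      · have h1 : c ≠ c1 := fun h => hne (h.symm.trans h0)
        rw [if_pos h0, if_neg h1]
        have := hodd c (h0 ▸ hc0)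
        omega
      · rw [if_neg h0]
        by_cases h1 : c = c1
        · rw [if_pos h1]
          have := hodd c (h1 ▸ hc1)
          omega
        · rw [if_neg h1]
          simpa using h4 _ (hnc c)
    have h := Finset.sum_le_sum (s := Finset.univ) fun c _ => hlow c
    rw [hsum] at h
    simp only [Finset.sum_add_distrib, Finset.sum_const, Finset.card_univ, Finset.sum_ite_eq',
      Finset.mem_univ, if_true, smul_eq_mul] at h
    omega

theorem finrank_eq_card_of_indep {W : Type*} [AddCommGroup W] [Module (ZMod 2) W]
    (x : E → W) (I : Finset E) (h : LinearIndepOn (ZMod 2) x (I : Set E)) :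
    Module.finrank (ZMod 2) (Submodule.span (ZMod 2) (x '' (I : Set E))) = I.card := by
  have h1 := finrank_span_eq_card (R := ZMod 2) (b := fun i : (I : Set E) => x i) h
  have h2 : Set.range (fun i : (I : Set E) => x i) = x '' (I : Set E) := by
    ext; simp
  rw [h2] at h1
  rw [h1]; simp

theorem finrank_map_of_ker_le {W : Type*} [AddCommGroup W] [Module (ZMod 2) W]
    [FiniteDimensional (ZMod 2) W] (p : W →ₗ[ZMod 2] W) (M : Submodule (ZMod 2) W)
    (h : LinearMap.ker p ≤ M) :
    Module.finrank (ZMod 2) (M.map p) + Module.finrank (ZMod 2) (LinearMap.ker p) =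
      Module.finrank (ZMod 2) M := by
  have h1 := LinearMap.finrank_range_add_finrank_ker (p.domRestrict M)
  rw [LinearMap.range_domRestrict, LinearMap.ker_domRestrict] at h1
  have h2 := (Submodule.comapSubtypeEquivOfLe h).finrank_eq
  rw [← h1, ← h2]

theorem exists_proj {W : Type*} [AddCommGroup W] [Module (ZMod 2) W]
    (M : Submodule (ZMod 2) W) : ∃ p : W →ₗ[ZMod 2] W, LinearMap.ker p = M := by
  obtain ⟨g, hg⟩ := LinearMap.exists_rightInverse_of_surjective M.mkQ M.range_mkQ
  refine ⟨g ∘ₗ M.mkQ, ?_⟩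
  have hinj : LinearMap.ker g = ⊥ := by
    rw [LinearMap.ker_eq_bot]
    intro x y hxy
    have := congrArg M.mkQ hxy
    rwa [← LinearMap.comp_apply, ← LinearMap.comp_apply, hg] at this
  rw [LinearMap.ker_comp_of_ker_eq_bot _ hinj, Submodule.ker_mkQ]

/-- Vertices joined by `Q`. -/
def relU (a b : E → V) (Q : Finset E) : Setoid V where
  r v w := (Pi.single v 1 + Pi.single w 1 : V → ZMod 2) ∈ U a b Q
  iseqv := by
    refine ⟨fun v => ?_, fun {v w} h => ?_, fun {u v w} h h' => ?_⟩
    · have : (Pi.single v 1 + Pi.single v 1 : V → ZMod 2) = 0 := by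
        ext z; exact z2add _
      rw [this]; exact Submodule.zero_mem _
    · rw [add_comm]; exact h
    · have := Submodule.add_mem _ h h'
      convert this using 1
      ext z
      simp only [Pi.add_apply]
      have := z2add ((Pi.single v 1 : V → ZMod 2) z)
      linear_combination -this

theorem card_le_relU (a b : E → V) (Q : Finset E) [Fintype (Quotient (relU a b Q))] :
    Fintype.card V ≤ Module.finrank (ZMod 2) (U a b Q) +
      Fintype.card (Quotient (relU a b Q)) := by
  classical
  let r : Quotient (relU a b Q) → (V → ZMod 2) := fun c => Pi.single c.out 1
  have htop : U a b Q ⊔ Submodule.span (ZMod 2) (Set.range r) = ⊤ := by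
    rw [eq_top_iff]
    intro w _
    have hw : w = ∑ v, w v • (Pi.single v 1 : V → ZMod 2) := by
      ext z; simp [Finset.sum_apply, Pi.single_apply]
    rw [hw]
    refine Submodule.sum_mem _ fun v _ => Submodule.smul_mem _ _ ?_
    have h1 : (relU a b Q) v (⟦v⟧ : Quotient (relU a b Q)).out :=
      (relU a b Q).symm (Quotient.mk_out v)
    have h2 : r ⟦v⟧ ∈ Submodule.span (ZMod 2) (Set.range r) := Submodule.subset_span ⟨_, rfl⟩
    have h3 := Submodule.add_mem_sup (show _ ∈ U a b Q from h1) h2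
    convert h3 using 1
    ext z
    simp only [Pi.add_apply, r]
    have := z2add ((Pi.single (⟦v⟧ : Quotient (relU a b Q)).out 1 : V → ZMod 2) z)
    linear_combination -this
  have h1 := Submodule.finrank_add_le_finrank_add_finrank (U a b Q)
    (Submodule.span (ZMod 2) (Set.range r))
  rw [htop] at h1
  have h2 := finrank_range_le_card (R := ZMod 2) r
  simp [Set.finrank] at h1 h2
  omega



theorem main4 [Nonempty V] (a b : E → V) (m : ℕ) (hm : 3 ≤ m)
    (hsp : Spans a b Finset.univ)
    (h4 : ∀ χ : V → ZMod 2, (∃ v w, χ v ≠ χ w) → 4 ≤ (cutF a b χ).card)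
    (hno : NoOdd a b m) (S : Finset E) (hS : S.card ≤ m) :
    ∃ F, S ⊆ F ∧ EvenF a b F ∧ Spans a b F := by
  classical
  obtain ⟨p, hp⟩ := exists_proj (U a b S)
  let x : Bool → E → (V → ZMod 2) := fun i e => bif i then p (xv a b e) else xv a b e
  obtain ⟨I, Q, ⟨hIN, hdis, hind⟩, hQN, hcov, hspan⟩ :=
    packing (K := ZMod 2) x (Finset.univ \ S)
  obtain ⟨I1, hI1⟩ : ∃ I1, I1 = I true := ⟨_, rfl⟩
  obtain ⟨I2, hI2⟩ : ∃ I2, I2 = I false := ⟨_, rfl⟩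
  have hi1 := hind true
  have hi2 : LinearIndepOn (ZMod 2) (xv a b) (I2 : Set E) := hI2 ▸ hind false
  have hs1 := hspan true
  have hs2 := hspan false
  have hN1 := hIN true
  have hN2 := hIN false
  rw [← hI1] at hi1 hs1 hdis hN1
  rw [← hI2] at hs2 hdis hN2
  let fr : Finset E → ℕ := fun A => Module.finrank (ZMod 2) (U a b A)
  have e1 : I2.card = fr I2 := (finrank_eq_card_of_indep (xv a b) I2 hi2).symm
  have hUQ : U a b Q = U a b (I2 ∩ Q) := by
    apply le_antisymm
    · rw [U, Submodule.span_le]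
      rintro _ ⟨q, hq, rfl⟩
      exact hs2 q hq
    · exact U_mono a b Finset.inter_subset_right
  have e2 : (I2 ∩ Q).card = fr Q := by
    have : fr Q = fr (I2 ∩ Q) := by change Module.finrank _ _ = Module.finrank _ _; rw [hUQ]
    rw [this]
    exact (finrank_eq_card_of_indep (xv a b) (I2 ∩ Q)
      (hi2.mono (by exact_mod_cast Finset.inter_subset_left))).symm
  have hmap : ∀ A : Finset E, (U a b A).map p = Submodule.span (ZMod 2) (x true '' (A : Set E)) := by
    intro A
    rw [U, Submodule.map_span, Set.image_image]
    rfl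
  have hmapS : ∀ A : Finset E, (U a b (A ∪ S)).map p = (U a b A).map p := by
    intro A
    have : (U a b S).map p = ⊥ := by rw [← hp]; exact LinearMap.le_ker_iff_map.1 le_rfl
    rw [U_union, Submodule.map_sup, this, sup_bot_eq]
  have hfr1 : ∀ A : Finset E, LinearIndepOn (ZMod 2) (x true) (A : Set E) →
      A.card + fr S = fr (A ∪ S) := by
    intro A hA
    have h1 := finrank_map_of_ker_le p (U a b (A ∪ S))
      (by rw [hp]; exact U_mono a b Finset.subset_union_right)
    rw [hmapS, hmap, finrank_eq_card_of_indep _ _ hA, hp] at h1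
    exact h1
  have hQ1 : U a b (Q ∪ S) = U a b ((I1 ∩ Q) ∪ S) := by
    apply le_antisymm
    · rw [U_union]
      refine sup_le ?_ (U_mono a b Finset.subset_union_right)
      rw [U, Submodule.span_le]
      rintro _ ⟨q, hq, rfl⟩
      have h1 := hs1 q hq
      rw [← hmap] at h1
      have h2 : xv a b q ∈ ((U a b (I1 ∩ Q)).map p).comap p := h1
      rw [Submodule.comap_map_eq, hp, ← U_union] at h2
      exact h2
    · exact U_mono a b (Finset.union_subset_union_left Finset.inter_subset_right)
  have e3 := hfr1 I1 hi1
  have e4 : (I1 ∩ Q).card + fr S = fr (Q ∪ S) := by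
    have := hfr1 (I1 ∩ Q) (hi1.mono (by exact_mod_cast Finset.inter_subset_left))
    rw [this]; change Module.finrank _ _ = Module.finrank _ _; rw [hQ1]
  have n1 : fr I2 + 1 ≤ Fintype.card V := finrank_U_lt a b I2
  have n2 : fr (I1 ∪ S) + 1 ≤ Fintype.card V := finrank_U_lt a b _
  have n3 : fr Finset.univ + 1 ≤ Fintype.card V := finrank_U_lt a b _
  by_cases hbase : fr I2 + 1 = Fintype.card V ∧ fr (I1 ∪ S) + 1 = Fintype.card V
  · have hfull : ∀ A, fr A + 1 = Fintype.card V → Spans a b A := by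
      intro A hA χ hχ
      have : U a b A = U a b Finset.univ :=
        Submodule.eq_of_le_of_finrank_le (U_mono a b (Finset.subset_univ _))
          (by change fr _ ≤ fr _; omega)
      apply hsp
      intro e _
      apply dd_zero_of_mem a b A χ hχ
      rw [this]
      exact mem_U a b (Finset.mem_univ e)
    obtain ⟨J, hJ, hJe⟩ := tjoin a b I2 (I1 ∪ S) (by
        rw [Finset.disjoint_union_left]
        refine ⟨hdis, ?_⟩
        rw [Finset.disjoint_left]
        intro e he he'
        have := hN2 he'
        simp [he] at this) (by
        intro χ hχ
        obtain ⟨c, hc⟩ := hfull I2 hbase.1 χ hχ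
        apply Finset.sum_eq_zero
        intro e _
        simp only [dd, hc, z2add])
    exact ⟨_, Finset.subset_union_right.trans Finset.subset_union_left, hJe,
      (hfull _ hbase.2).mono Finset.subset_union_left⟩
  · have hsum : fr I2 + fr (I1 ∪ S) + 3 ≤ 2 * Fintype.card V := by omega
    rcases part_count a b m hm h4 hno (relU a b Q) with hall | hcr
    · have hQc : ∀ χ : V → ZMod 2, (∀ e ∈ Q, dd a b χ e = 0) → ∑ e, dd a b χ e = 0 := by
        intro χ hχ
        apply hall
        intro v w hvw
        have := pair_zero_of_mem a b Q χ hχ hvw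
        rw [map_add, pair_single, pair_single, z2eq] at this
        exact this
      have hk2 : ∀ χ : V → ZMod 2, (∀ e ∈ I2 ∩ Q, dd a b χ e = 0) →
          ∀ e ∈ Q, dd a b χ e = 0 := by
        intro χ hχ e he
        exact dd_zero_of_mem a b _ χ hχ (hs2 e he)
      have hk1 : ∀ χ : V → ZMod 2, (∀ e ∈ (I1 ∩ Q) ∪ S, dd a b χ e = 0) →
          ∀ e ∈ Q, dd a b χ e = 0 := by
        intro χ hχ e he
        refine dd_zero_of_mem a b _ χ hχ ?_
        rw [← hQ1]
        exact mem_U a b (Finset.mem_union_left _ he)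
      have hSQ : S ⊆ Finset.univ \ Q := by
        intro e he
        simp only [Finset.mem_sdiff, Finset.mem_univ, true_and]
        intro hq
        have := hQN hq
        simp [he] at this
      obtain ⟨J, hJ, hJe⟩ := tjoin a b (I2 ∩ Q) ((Finset.univ \ Q) ∪ (I1 ∩ Q)) (by
          rw [Finset.disjoint_union_left]
          constructor
          · rw [Finset.disjoint_left]
            intro e he he'
            simp at he he'
            exact he he'.2
          · exact Finset.disjoint_of_subset_left Finset.inter_subset_left
              (Finset.disjoint_of_subset_right Finset.inter_subset_left hdis)) (by
          intro χ hχ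
          have h1 := hk2 χ hχ
          rw [← hQc χ h1]
          apply Finset.sum_subset (Finset.subset_univ _)
          intro e _ he
          apply h1
          by_contra hq
          exact he (by simp [hq]))
      refine ⟨_, (hSQ.trans Finset.subset_union_left).trans Finset.subset_union_left, hJe, ?_⟩
      refine Spans.mono ?_ Finset.subset_union_left
      intro χ hχ
      have h1 : ∀ e ∈ Q, dd a b χ e = 0 := by
        apply hk1
        intro e he
        apply hχ
        rcases Finset.mem_union.1 he with he | he
        · exact Finset.mem_union_right _ he
        · exact Finset.mem_union_left _ (hSQ he)
      apply hsp
      intro e _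
      by_cases he : e ∈ Q
      · exact h1 e he
      · exact hχ e (by simp [he])
    · exfalso
      set Cr := (Finset.univ.filter fun e =>
        (⟦a e⟧ : Quotient (relU a b Q)) ≠ ⟦b e⟧) with hCr
      have hmem : ∀ e, e ∈ Cr → xv a b e ∉ U a b Q := by
        intro e he h
        rw [hCr, Finset.mem_filter] at he
        exact he.2 (Quotient.sound h)
      have hsub : Cr ⊆ (Cr ∩ S) ∪ ((I1 \ Q) ∪ (I2 \ Q)) := by
        intro e he
        have hq : e ∉ Q := fun hq => hmem e he (mem_U a b hq)
        by_cases hes : e ∈ S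
        · simp [he, hes]
        · obtain ⟨i, hi⟩ := hcov e (by simp [hes]) hq
          cases i
          · rw [← hI2] at hi
            simp [hi, hq]
          · rw [← hI1] at hi
            simp [hi, hq]
      have c1 := Finset.card_le_card hsub
      have c2 := Finset.card_union_le (Cr ∩ S) ((I1 \ Q) ∪ (I2 \ Q))
      have c3 := Finset.card_union_le (I1 \ Q) (I2 \ Q)
      have c4 := Finset.card_sdiff_add_card_inter I1 Q
      have c5 := Finset.card_sdiff_add_card_inter I2 Q
      have c6 : (Cr ∩ S).card ≤ S.card := Finset.card_le_card Finset.inter_subset_right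
      have c7 : Fintype.card V ≤ fr Q + _ := card_le_relU a b Q
      have c8 : fr Q ≤ fr (Q ∪ S) :=
        Submodule.finrank_mono (U_mono a b Finset.subset_union_left)
      have c9 : 0 < (Cr ∩ S).card → fr Q + 1 ≤ fr (Q ∪ S) := by
        intro h
        obtain ⟨e, he⟩ := Finset.card_pos.1 h
        rw [Finset.mem_inter] at he
        apply Submodule.finrank_lt_finrank_of_lt
        refine lt_of_le_of_ne (U_mono a b Finset.subset_union_left) ?_
        intro heq
        apply hmem e he.1
        rw [heq]
        exact mem_U a b (Finset.mem_union_right _ he.2)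
      omega

end main4

section l2
variable {V E : Type*}

/-- The vertex `v` is an end of an edge of `A`. -/
def Touch (a b : E → V) (A : Finset E) (v : V) : Prop := ∃ f ∈ A, a f = v ∨ b f = v

theorem even_filter [DecidableEq E] (a b : E → V) {F : Finset E} (hF : EvenF a b F) (χ : V → ZMod 2)
    (hχ : ∀ e ∈ F, dd a b χ e = 0) (c : ZMod 2) :
    EvenF a b (F.filter fun e => χ (a e) = c) := by
  classical
  intro ψ
  rw [← hF fun v => if χ v = c then ψ v else 0, Finset.sum_filter]
  apply Finset.sum_congr rfl
  intro e he
  have h := z2eq.1 (hχ e he)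
  simp only [dd, ← h]
  split_ifs <;> simp

theorem even_symm [DecidableEq E] (a b : E → V) {A B : Finset E} (hA : EvenF a b A)
    (hB : EvenF a b B) : EvenF a b ((A \ B) ∪ (B \ A)) := by
  intro χ
  have h1 := hA χ
  have h2 := hB χ
  rw [← Finset.sum_inter_add_sum_sdiff A B] at h1
  rw [← Finset.sum_inter_add_sum_sdiff B A, Finset.inter_comm B A] at h2
  rw [Finset.sum_union disjoint_sdiff_sdiff]
  have h3 := z2add (∑ e ∈ A ∩ B, dd a b χ e)
  linear_combination h1 + h2 - h3

theorem even_union [DecidableEq E] (a b : E → V) {A B : Finset E} (hA : EvenF a b A)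
    (hB : EvenF a b B) (hd : Disjoint A B) : EvenF a b (A ∪ B) := by
  intro χ
  rw [Finset.sum_union hd, hA, hB, add_zero]

theorem min_conn [DecidableEq E] (a b : E → V) {F : Finset E} (hF : EvenF a b F) {e : E}
    (he : e ∈ F) : ∃ K ⊆ F, e ∈ K ∧ EvenF a b K ∧ ConnF a b K := by
  induction F using Finset.strongInduction with
  | H F ih =>
    by_cases hc : ConnF a b F
    · exact ⟨F, Finset.Subset.refl _, he, hF, hc⟩
    · simp only [ConnF] at hc
      push Not at hc
      obtain ⟨χ, hχ, hcc⟩ := hc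
      obtain ⟨f, hf, hfc⟩ := hcc (χ (a e))
      have hss : (F.filter fun e' => χ (a e') = χ (a e)) ⊂ F := by
        rw [Finset.filter_ssubset]
        exact ⟨f, hf, hfc⟩
      obtain ⟨K, h1, h2, h3⟩ := ih _ hss (even_filter a b hF χ hχ _) (by simp [he])
      exact ⟨K, h1.trans hss.subset, h2, h3⟩

theorem conn_touch (a b : E → V) {F : Finset E} (hF : ConnF a b F) (χ : V → ZMod 2)
    (hχ : ∀ e ∈ F, dd a b χ e = 0) {v w : V} (hv : Touch a b F v) (hw : Touch a b F w) :
    χ v = χ w := by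
  obtain ⟨c, hc⟩ := hF χ hχ
  have : ∀ v, Touch a b F v → χ v = c := by
    rintro v ⟨f, hf, rfl | rfl⟩
    · exact hc f hf
    · rw [← z2eq.1 (hχ f hf)]; exact hc f hf
  rw [this v hv, this w hw]

theorem conn_union [DecidableEq E] (a b : E → V) {A B : Finset E} (hA : ConnF a b A)
    (hB : ConnF a b B) {z : V} (hzA : Touch a b A z) (hzB : Touch a b B z) :
    ConnF a b (A ∪ B) := by
  intro χ hχ
  refine ⟨χ z, fun e he => ?_⟩
  rcases Finset.mem_union.1 he with he | he
  · exact conn_touch a b hA χ (fun e he => hχ e (Finset.mem_union_left _ he))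
      ⟨e, he, Or.inl rfl⟩ hzA
  · exact conn_touch a b hB χ (fun e he => hχ e (Finset.mem_union_right _ he))
      ⟨e, he, Or.inl rfl⟩ hzB

theorem exists_even [Fintype E] [DecidableEq E] (a b : E → V) (hno : NoOdd a b 1) (e : E) :
    ∃ F, e ∈ F ∧ EvenF a b F := by
  obtain ⟨J, hJ, hJe⟩ := tjoin a b (Finset.univ.erase e) {e} (by simp) (by
    intro χ hχ
    rw [Finset.sum_singleton]
    by_contra h
    have hc : cutF a b χ = {e} := by
      ext f
      rw [mem_cutF, Finset.mem_singleton]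
      constructor
      · intro hf
        by_contra hne
        exact hf (hχ f (by simp [hne]))
      · rintro rfl; exact h
    have := hno χ (by rw [hc]; simp)
    rw [hc] at this
    simp at this)
  exact ⟨_, by simp, hJe⟩

theorem L1 [Fintype E] [DecidableEq E] (a b : E → V) (hno : NoOdd a b 1) (e : E) :
    ∃ F, e ∈ F ∧ EvenF a b F ∧ ConnF a b F := by
  obtain ⟨F, h1, h2⟩ := exists_even a b hno e
  obtain ⟨K, _, h⟩ := min_conn a b h2 h1
  exact ⟨K, h⟩

theorem NoOdd.comp [Fintype E] {V' : Type*} {a b : E → V} {m : ℕ} (h : NoOdd a b m) (π : V → V') :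
    NoOdd (π ∘ a) (π ∘ b) m := fun χ hχ => h (χ ∘ π) hχ

theorem NoOdd.mono [Fintype E] {a b : E → V} {m m' : ℕ} (h : NoOdd a b m) (hm : m' ≤ m) :
    NoOdd a b m' := fun χ hχ => lt_of_le_of_lt hm (h χ hχ)

theorem EvenF.comp {V' : Type*} {a b : E → V} {F : Finset E} (h : EvenF a b F) (π : V → V') :
    EvenF (π ∘ a) (π ∘ b) F := fun χ => h (χ ∘ π)

theorem L2claim [Fintype E] [DecidableEq E] (a b : E → V) (hno : NoOdd a b 1) (e q : E)
    (F : Finset E) (he : e ∈ F) (hF : EvenF a b F) (hFc : ConnF a b F) (hq : q ∉ F)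
    (w : V) (hw : Touch a b F w) (hqw : a q = w ∨ b q = w) :
    ∃ F', e ∈ F' ∧ q ∈ F' ∧ EvenF a b F' ∧ ConnF a b F' := by
  classical
  let π : V → V := fun v => if Touch a b F v then w else v
  have hπF : ∀ f ∈ F, ∀ χ : V → ZMod 2, dd (π ∘ a) (π ∘ b) χ f = 0 := by
    intro f hf χ
    have h1 : Touch a b F (a f) := ⟨f, hf, Or.inl rfl⟩
    have h2 : Touch a b F (b f) := ⟨f, hf, Or.inr rfl⟩
    simp only [dd, π, Function.comp, if_pos h1, if_pos h2, z2add]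
  have hπc : ∀ χ : V → ZMod 2, (∀ f ∈ F, dd a b χ f = 0) → χ ∘ π = χ := by
    intro χ hχ
    funext v
    simp only [π, Function.comp]
    split_ifs with h
    · exact conn_touch a b hFc χ hχ hw h
    · rfl
  -- minimal contracted even set
  let P : Finset E → Prop := fun D => q ∈ D ∧ EvenF (π ∘ a) (π ∘ b) D
  obtain ⟨D, hD⟩ : ∃ D, Minimal P D := by
    obtain ⟨D0, h0⟩ := exists_even (π ∘ a) (π ∘ b) (hno.comp π) q
    obtain ⟨D, _, hD⟩ := exists_minimal_le_of_wellFoundedLT P D0 h0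
    exact ⟨D, hD⟩
  have hqD : q ∈ D := hD.prop.1
  have hsd : ∀ Y, q ∈ Y → EvenF (π ∘ a) (π ∘ b) Y → Y ⊆ F ∪ D → D ⊆ Y := by
    intro Y hqY hY hYs
    have h1 : P (Y \ F) := by
      refine ⟨by simp [hqY, hq], fun χ => ?_⟩
      rw [← hY χ]
      apply Finset.sum_subset Finset.sdiff_subset
      intro f hf hf'
      apply hπF
      by_contra h
      exact hf' (by simp [hf, h])
    have h2 : Y \ F ⊆ D := by
      intro f hf
      rw [Finset.mem_sdiff] at hf
      rcases Finset.mem_union.1 (hYs hf.1) with h | h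
      · exact absurd h hf.2
      · exact h
    exact (hD.le_of_le h1 h2).trans Finset.sdiff_subset
  have hDF : Disjoint D F := by
    have h1 : P (D \ F) := by
      refine ⟨by simp [hqD, hq], fun χ => ?_⟩
      rw [← hD.prop.2 χ]
      apply Finset.sum_subset Finset.sdiff_subset
      intro f hf hf'
      apply hπF
      by_contra h
      exact hf' (by simp [hf, h])
    have h2 := hD.le_of_le h1 Finset.sdiff_subset
    rw [Finset.disjoint_left]
    intro f hf
    exact (Finset.mem_sdiff.1 (h2 hf)).2
  -- connected even sets between
  let R : Finset E → Prop := fun F' => D ⊆ F' ∧ F' ⊆ F ∪ D ∧ EvenF a b F' ∧ ConnF a b F'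
  obtain ⟨F0, hF0⟩ : ∃ F0, R F0 := by
    obtain ⟨J, hJ, hJe⟩ := tjoin a b F D hDF (by
      intro χ hχ
      have := hD.prop.2 χ
      rw [← this]
      apply Finset.sum_congr rfl
      intro f _
      change _ = dd a b (χ ∘ π) f
      rw [hπc χ hχ])
    obtain ⟨K, hK, hqK, hKe, hKc⟩ := min_conn a b hJe (Finset.mem_union_left J hqD)
    have hKs : K ⊆ F ∪ D := by
      refine hK.trans ?_
      rw [Finset.union_comm F D]
      exact Finset.union_subset_union_right hJ
    exact ⟨K, hsd K hqK (hKe.comp π) hKs, hKs, hKe, hKc⟩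
  obtain ⟨F', _, hF'⟩ := exists_maximal_ge_of_wellFoundedGT R F0 hF0
  obtain ⟨hDF', hF's, hF'e, hF'c⟩ := hF'.prop
  by_cases heF : e ∈ F'
  · exact ⟨F', heF, hDF' hqD, hF'e, hF'c⟩
  have hMe := even_symm a b hF hF'e
  have hMD : F' \ F = D := by
    ext f
    rw [Finset.mem_sdiff]
    constructor
    · rintro ⟨h1, h2⟩
      rcases Finset.mem_union.1 (hF's h1) with h | h
      · exact absurd h h2
      · exact h
    · intro h
      exact ⟨hDF' h, Finset.disjoint_left.1 hDF h⟩
  rw [hMD] at hMe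
  refine ⟨F \ F' ∪ D, by simp [he, heF], by simp [hqD], hMe, ?_⟩
  by_contra hnc
  simp only [ConnF] at hnc
  push Not at hnc
  obtain ⟨χ, hχ, hcc⟩ := hnc
  obtain ⟨k0, hk0, hk0c⟩ := hcc (χ (a q))
  have hYD : D ⊆ (F \ F' ∪ D).filter fun e => χ (a e) = χ (a q) := by
    apply hsd
    · simp [hqD]
    · exact (even_filter a b hMe χ hχ _).comp π
    · refine (Finset.filter_subset _ _).trans ?_
      exact Finset.union_subset_union_left Finset.sdiff_subset
  let K := (F \ F' ∪ D).filter fun e => χ (a e) = χ (a q) + 1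
  have hKe : EvenF a b K := even_filter a b hMe χ hχ _
  have hne1 : ∀ x y : ZMod 2, x ≠ y ↔ x = y + 1 := by decide
  have hK1 : ∀ f ∈ K, f ∈ F ∧ f ∉ F' := by
    intro f hf
    rw [Finset.mem_filter, Finset.mem_union] at hf
    rcases hf.1 with h | h
    · exact Finset.mem_sdiff.1 h
    · have := (Finset.mem_filter.1 (hYD h)).2
      exact absurd this ((hne1 _ _).2 hf.2)
  have hKχ : ∀ v, Touch a b K v → χ v ≠ χ (a q) := by
    rintro v ⟨f, hf, h⟩
    have h2 := Finset.mem_filter.1 hf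
    have h3 := z2eq.1 (hχ f h2.1)
    rw [hne1]
    rcases h with rfl | rfl
    · exact h2.2
    · rw [← h3]; exact h2.2
  have hk0K : k0 ∈ K := Finset.mem_filter.2 ⟨hk0, (hne1 _ _).1 hk0c⟩
  have hshare : ∃ z, Touch a b K z ∧ Touch a b F' z := by
    by_contra hns
    push Not at hns
    let ψ : V → ZMod 2 := fun v => if Touch a b K v then 1 else 0
    have hψ : ∀ f ∈ F, dd a b ψ f = 0 := by
      intro f hf
      by_cases hfK : f ∈ K
      · have h1 : Touch a b K (a f) := ⟨f, hfK, Or.inl rfl⟩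
        have h2 : Touch a b K (b f) := ⟨f, hfK, Or.inr rfl⟩
        simp only [dd, ψ, if_pos h1, if_pos h2, z2add]
      · have : ¬ Touch a b K (a f) ∧ ¬ Touch a b K (b f) := by
          by_cases hf' : f ∈ F'
          · exact ⟨fun h => hns _ h ⟨f, hf', Or.inl rfl⟩, fun h => hns _ h ⟨f, hf', Or.inr rfl⟩⟩
          · have h1 : f ∈ F \ F' ∪ D := by simp [hf, hf']
            have h2 : χ (a f) = χ (a q) := by
              by_contra h
              exact hfK (Finset.mem_filter.2 ⟨h1, (hne1 _ _).1 h⟩)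
            have h3 := z2eq.1 (hχ f h1)
            exact ⟨fun h => hKχ _ h h2, fun h => hKχ _ h (h3.symm.trans h2)⟩
        simp only [dd, ψ, if_neg this.1, if_neg this.2, z2add]
    have h1 := conn_touch a b hFc ψ hψ hw ⟨k0, (hK1 k0 hk0K).1, Or.inl rfl⟩
    have h2 : Touch a b K (a k0) := ⟨k0, hk0K, Or.inl rfl⟩
    have h3 : ¬ Touch a b K w := fun h => hns _ h ⟨q, hDF' hqD, hqw⟩
    simp only [ψ, if_pos h2, if_neg h3] at h1
    exact zero_ne_one h1
  obtain ⟨z, ⟨k, hkK, hkz⟩, hzF⟩ := hshare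
  obtain ⟨K', hK's, hkK', hK'e, hK'c⟩ := min_conn a b hKe hkK
  have hR : R (F' ∪ K') := by
    refine ⟨hDF'.trans Finset.subset_union_left, ?_, ?_, ?_⟩
    · refine Finset.union_subset hF's ?_
      intro f hf
      exact Finset.mem_union_left _ (hK1 f (hK's hf)).1
    · refine even_union a b hF'e hK'e ?_
      rw [Finset.disjoint_right]
      intro f hf
      exact (hK1 f (hK's hf)).2
    · exact conn_union a b hF'c hK'c hzF ⟨k, hkK', hkz⟩
  have := hF'.le_of_ge hR Finset.subset_union_left
  exact (hK1 k hkK).2 (this (Finset.mem_union_right _ hkK'))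

theorem L2 [Fintype E] [DecidableEq E] (a b : E → V) (hno : NoOdd a b 1)
    (hsp : Spans a b Finset.univ) (e q : E) :
    ∃ F, e ∈ F ∧ q ∈ F ∧ EvenF a b F ∧ ConnF a b F := by
  classical
  let Z : Finset E := Finset.univ.filter fun q =>
    ∃ F, e ∈ F ∧ q ∈ F ∧ EvenF a b F ∧ ConnF a b F
  have hZ : ∀ q, q ∈ Z ↔ ∃ F, e ∈ F ∧ q ∈ F ∧ EvenF a b F ∧ ConnF a b F := by
    intro q; simp [Z]
  have hstep : ∀ q v, Touch a b Z v → (a q = v ∨ b q = v) → q ∈ Z := by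
    rintro q v ⟨z, hz, hzv⟩ hqv
    obtain ⟨F, h1, h2, h3, h4⟩ := (hZ z).1 hz
    rw [hZ]
    by_cases hqF : q ∈ F
    · exact ⟨F, h1, hqF, h3, h4⟩
    · exact L2claim a b hno e q F h1 h3 h4 hqF v ⟨z, h2, hzv⟩ hqv
  have heZ : e ∈ Z := by
    obtain ⟨F, h1, h2⟩ := L1 a b hno e
    exact (hZ e).2 ⟨F, h1, h1, h2⟩
  let ψ : V → ZMod 2 := fun v => if Touch a b Z v then 1 else 0
  obtain ⟨c, hc⟩ := hsp ψ (by
    intro f _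
    by_cases hf : f ∈ Z
    · have h1 : Touch a b Z (a f) := ⟨f, hf, Or.inl rfl⟩
      have h2 : Touch a b Z (b f) := ⟨f, hf, Or.inr rfl⟩
      simp only [dd, ψ, if_pos h1, if_pos h2, z2add]
    · have h1 : ¬ Touch a b Z (a f) := fun h => hf (hstep f _ h (Or.inl rfl))
      have h2 : ¬ Touch a b Z (b f) := fun h => hf (hstep f _ h (Or.inr rfl))
      simp only [dd, ψ, if_neg h1, if_neg h2, z2add])
  have h1 : Touch a b Z (a e) := ⟨e, heZ, Or.inl rfl⟩
  have h2 : Touch a b Z (a q) := by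
    by_contra h
    have := (hc (a e)).trans (hc (a q)).symm
    simp only [ψ, if_pos h1, if_neg h] at this
    exact one_ne_zero this
  exact (hZ q).1 (hstep q _ h2 (Or.inl rfl))

end l2

universe u

section ind
variable {V E : Type*}

open Classical in
/-- Contract one side of a cut to a vertex. -/
noncomputable def con (χ : V → ZMod 2) (s : ZMod 2) (x0 : V) (v : V) : V :=
  if χ v = s then x0 else v

theorem z2two {s t : ZMod 2} (h : s ≠ t) (x : ZMod 2) : x = s ∨ x = t := by
  revert s t x; decide

theorem con_pos {χ : V → ZMod 2} {s : ZMod 2} {x0 v : V} (h : χ v = s) : con χ s x0 v = x0 :=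
  if_pos h

theorem con_neg {χ : V → ZMod 2} {s : ZMod 2} {x0 v : V} (h : χ v ≠ s) : con χ s x0 v = v :=
  if_neg h

theorem con_chi {χ : V → ZMod 2} {s : ZMod 2} {x0 : V} (h0 : χ x0 = s) (v : V) :
    χ (con χ s x0 v) = χ v := by
  by_cases h : χ v = s
  · rw [con_pos h, h, h0]
  · rw [con_neg h]

theorem con_const {χ ψ : V → ZMod 2} {s : ZMod 2} {x0 : V} (h0 : χ x0 = s)
    (h : ∀ v w, χ v = s → χ w = s → ψ v = ψ w) (v : V) : ψ (con χ s x0 v) = ψ v := by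
  by_cases h1 : χ v = s
  · rw [con_pos h1]; exact h _ _ h0 h1
  · rw [con_neg h1]

theorem sum_split [DecidableEq E] (a b : E → V) (χ : V → ZMod 2) (g g' : E) (hgg : g ≠ g')
    (hcut : ∀ e, dd a b χ e ≠ 0 ↔ e = g ∨ e = g') {s t : ZMod 2} (hst : s ≠ t)
    (F : Finset E) (h : E → ZMod 2) :
    ∑ e ∈ F, h e = (if g ∈ F then h g else 0) + (if g' ∈ F then h g' else 0) +
      ∑ e ∈ F.filter (fun e => χ (a e) = t ∧ χ (b e) = t), h e +
      ∑ e ∈ F.filter (fun e => χ (a e) = s ∧ χ (b e) = s), h e := by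
  have hp : ∀ e ∈ F, h e = (if e = g then h e else 0) + (if e = g' then h e else 0) +
      (if χ (a e) = t ∧ χ (b e) = t then h e else 0) +
      (if χ (a e) = s ∧ χ (b e) = s then h e else 0) := by
    intro e _
    have hc := hcut e
    by_cases hcc : e = g ∨ e = g'
    · have h1 := hc.2 hcc
      have h2 : χ (a e) ≠ χ (b e) := fun h => h1 (z2eq.2 h)
      have h3 : ¬ (χ (a e) = t ∧ χ (b e) = t) := fun h => h2 (h.1.trans h.2.symm)
      have h4 : ¬ (χ (a e) = s ∧ χ (b e) = s) := fun h => h2 (h.1.trans h.2.symm)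
      rw [if_neg h3, if_neg h4, add_zero, add_zero]
      rcases hcc with rfl | rfl
      · rw [if_pos rfl, if_neg hgg, add_zero]
      · rw [if_pos rfl, if_neg hgg.symm, zero_add]
    · have h1 : χ (a e) = χ (b e) := by
        rw [← z2eq]
        by_contra h
        exact hcc (hc.1 h)
      push Not at hcc
      rw [if_neg hcc.1, if_neg hcc.2, ← h1]
      rcases z2two hst (χ (a e)) with h | h
      · rw [h]; simp [hst]
      · rw [h]; simp [hst.symm]
  rw [Finset.sum_congr rfl hp]
  simp only [Finset.sum_add_distrib, Finset.sum_ite_eq', Finset.sum_filter]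

theorem par [DecidableEq E] (a b : E → V) (χ : V → ZMod 2) (g g' : E) (hgg : g ≠ g')
    (hcut : ∀ e, dd a b χ e ≠ 0 ↔ e = g ∨ e = g')
    (F : Finset E) (hF : ∑ e ∈ F, dd a b χ e = 0) (hg : g ∈ F) : g' ∈ F := by
  by_contra hg'
  rw [sum_split a b χ g g' hgg hcut zero_ne_one, if_pos hg, if_neg hg'] at hF
  have h1 : ∀ u, ∑ e ∈ F.filter (fun e => χ (a e) = u ∧ χ (b e) = u), dd a b χ e = 0 := by
    intro u
    apply Finset.sum_eq_zero
    intro e he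
    have := (Finset.mem_filter.1 he).2
    rw [dd, this.1, this.2, z2add]
  rw [h1, h1] at hF
  simp only [add_zero] at hF
  exact (hcut g).2 (Or.inl rfl) hF

theorem con_even_chi {a b : E → V} {χ : V → ZMod 2} {s : ZMod 2} {x0 : V} (hx0 : χ x0 = s)
    {F : Finset E} (hF : EvenF (con χ s x0 ∘ a) (con χ s x0 ∘ b) F) :
    ∑ e ∈ F, dd a b χ e = 0 := by
  rw [← hF χ]
  apply Finset.sum_congr rfl
  intro e _
  simp only [dd, Function.comp, con_chi hx0]

/-- Contracted sum on the far side of the cut. -/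
theorem con_sum [DecidableEq E] (a b : E → V) (χ : V → ZMod 2) (g g' : E) (hgg : g ≠ g')
    (hcut : ∀ e, dd a b χ e ≠ 0 ↔ e = g ∨ e = g') {s t : ZMod 2} (hst : s ≠ t)
    (x0 : V) (F : Finset E)
    (hF : EvenF (con χ s x0 ∘ a) (con χ s x0 ∘ b) F) (ψ : V → ZMod 2) :
    (if g ∈ F then dd (con χ s x0 ∘ a) (con χ s x0 ∘ b) ψ g else 0) +
    (if g' ∈ F then dd (con χ s x0 ∘ a) (con χ s x0 ∘ b) ψ g' else 0) +
      ∑ e ∈ F.filter (fun e => χ (a e) = t ∧ χ (b e) = t), dd a b ψ e = 0 := by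
  have h := hF ψ
  rw [sum_split a b χ g g' hgg hcut hst] at h
  have h1 : ∑ e ∈ F.filter (fun e => χ (a e) = s ∧ χ (b e) = s),
      dd (con χ s x0 ∘ a) (con χ s x0 ∘ b) ψ e = 0 := by
    apply Finset.sum_eq_zero
    intro e he
    have := (Finset.mem_filter.1 he).2
    simp only [dd, Function.comp, con_pos this.1, con_pos this.2, z2add]
  rw [h1, add_zero] at h
  refine Eq.trans ?_ h
  congr 1
  apply Finset.sum_congr rfl
  intro e he
  have := (Finset.mem_filter.1 he).2
  simp only [dd, Function.comp]
  rw [con_neg (by rw [this.1]; exact hst.symm), con_neg (by rw [this.2]; exact hst.symm)]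

/-- Connectivity on one side of a glued set. -/
theorem con_half [DecidableEq E] (a b : E → V) (χ : V → ZMod 2) (g g' : E) (hgg : g ≠ g')
    (hcut : ∀ e, dd a b χ e ≠ 0 ↔ e = g ∨ e = g') {s t : ZMod 2} (hst : s ≠ t)
    (x0 : V) (hx0 : χ x0 = s) (F : Finset E)
    (hF : EvenF (con χ s x0 ∘ a) (con χ s x0 ∘ b) F)
    (hFc : ConnF (con χ s x0 ∘ a) (con χ s x0 ∘ b) F) (hg : g ∈ F) (ψ : V → ZMod 2)
    (h1 : dd a b ψ g = 0) (h2 : dd a b ψ g' = 0)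
    (h3 : ∀ e ∈ F, χ (a e) = t → χ (b e) = t → dd a b ψ e = 0) :
    ψ (a g') = ψ (a g) ∧ ∀ e ∈ F, χ (a e) = t → χ (b e) = t → ψ (a e) = ψ (a g) := by
  classical
  have hg' : g' ∈ F := par a b χ g g' hgg hcut F (con_even_chi hx0 hF) hg
  let φ : V → ZMod 2 := fun v => if χ v = s then ψ (a g) else ψ v
  have hφp : ∀ v, χ v = s → φ v = ψ (a g) := fun v h => if_pos h
  have hφn : ∀ v, χ v ≠ s → φ v = ψ v := fun v h => if_neg h
  have hφc : ∀ v, φ (con χ s x0 v) = φ v :=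
    con_const hx0 fun v w hv hw => by rw [hφp v hv, hφp w hw]
  have hφd : ∀ e, dd (con χ s x0 ∘ a) (con χ s x0 ∘ b) φ e = dd a b φ e := by
    intro e; simp only [dd, Function.comp, hφc]
  have hag : ∀ v, (v = a g ∨ v = b g) → φ v = ψ (a g) := by
    intro v hv
    by_cases h : χ v = s
    · exact hφp v h
    · rw [hφn v h]
      rcases hv with rfl | rfl
      · rfl
      · exact (z2eq.1 h1).symm
  have hφg : dd a b φ g = 0 := by
    rw [dd, hag _ (Or.inl rfl), hag _ (Or.inr rfl), z2add]
  have hφY : ∀ e ∈ F, χ (a e) = t → χ (b e) = t → dd a b φ e = 0 := by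
    intro e he ha hb
    rw [dd, hφn _ (by rw [ha]; exact hst.symm), hφn _ (by rw [hb]; exact hst.symm)]
    exact h3 e he ha hb
  have hφX : ∀ e, χ (a e) = s → χ (b e) = s → dd a b φ e = 0 := by
    intro e ha hb
    rw [dd, hφp _ ha, hφp _ hb, z2add]
  have hs := con_sum a b χ g g' hgg hcut hst x0 F hF φ
  rw [if_pos hg, if_pos hg', hφd, hφd, hφg, zero_add, Finset.sum_eq_zero (by
    intro e he
    have := Finset.mem_filter.1 he
    exact hφY e this.1 this.2.1 this.2.2), add_zero] at hs
  have hall : ∀ e ∈ F, dd a b φ e = 0 := by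
    intro e he
    by_cases hc : dd a b χ e = 0
    · have hab := z2eq.1 hc
      rcases z2two hst (χ (a e)) with h | h
      · exact hφX e h (hab ▸ h)
      · exact hφY e he h (hab ▸ h)
    · rcases (hcut e).1 hc with rfl | rfl
      · exact hφg
      · exact hs
  obtain ⟨c, hc⟩ := hFc φ (fun e he => by rw [hφd]; exact hall e he)
  simp only [Function.comp, hφc] at hc
  have hcc : c = ψ (a g) := by rw [← hc g hg]; exact hag _ (Or.inl rfl)
  subst hcc
  constructor
  · rcases z2two hst (χ (a g')) with h | h
    · have hb : χ (b g') ≠ s := by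
        intro hb
        exact (hcut g').2 (Or.inr rfl) (z2eq.2 (h.trans hb.symm))
      have h4 := z2eq.1 (hall g' hg')
      rw [hφn _ hb, hc g' hg'] at h4
      rw [h4]; exact z2eq.1 h2
    · rw [← hc g' hg', hφn _ (by rw [h]; exact hst.symm)]
  · intro e he ha hb
    rw [← hc e he, hφn _ (by rw [ha]; exact hst.symm)]

/-- Glue two sets along a 2-edge cut. -/
theorem glue [DecidableEq E] (a b : E → V) (χ : V → ZMod 2) (g g' : E) (hgg : g ≠ g')
    (hcut : ∀ e, dd a b χ e ≠ 0 ↔ e = g ∨ e = g') {s t : ZMod 2} (hst : s ≠ t)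
    (x0 : V) (hx0 : χ x0 = s) (y0 : V) (hy0 : χ y0 = t) (F1 F2 : Finset E)
    (hF1 : EvenF (con χ s x0 ∘ a) (con χ s x0 ∘ b) F1)
    (hFc1 : ConnF (con χ s x0 ∘ a) (con χ s x0 ∘ b) F1) (hg1 : g ∈ F1)
    (hF2 : EvenF (con χ t y0 ∘ a) (con χ t y0 ∘ b) F2)
    (hFc2 : ConnF (con χ t y0 ∘ a) (con χ t y0 ∘ b) F2) (hg2 : g ∈ F2) :
    ∃ F, g ∈ F ∧ g' ∈ F ∧ (∀ e ∈ F1, χ (a e) = t → χ (b e) = t → e ∈ F) ∧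
      (∀ e ∈ F2, χ (a e) = s → χ (b e) = s → e ∈ F) ∧ EvenF a b F ∧ ConnF a b F := by
  classical
  have hg1' : g' ∈ F1 := par a b χ g g' hgg hcut F1 (con_even_chi hx0 hF1) hg1
  have hg2' : g' ∈ F2 := par a b χ g g' hgg hcut F2 (con_even_chi hy0 hF2) hg2
  let F := {g, g'} ∪ (F1.filter (fun e => χ (a e) = t ∧ χ (b e) = t) ∪
    F2.filter (fun e => χ (a e) = s ∧ χ (b e) = s))
  have hgF : g ∈ F := by simp [F]
  have hgF' : g' ∈ F := by simp [F]
  have hncut : ∀ e, (e = g ∨ e = g') → ∀ u, ¬ (χ (a e) = u ∧ χ (b e) = u) := by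
    intro e he u hu
    exact (hcut e).2 he (z2eq.2 (hu.1.trans hu.2.symm))
  have hm : ∀ e, e ∈ F ↔ (e = g ∨ e = g') ∨ (e ∈ F1 ∧ χ (a e) = t ∧ χ (b e) = t) ∨
      (e ∈ F2 ∧ χ (a e) = s ∧ χ (b e) = s) := by
    intro e
    simp only [F, Finset.mem_union, Finset.mem_insert, Finset.mem_singleton, Finset.mem_filter]
  have hft : F.filter (fun e => χ (a e) = t ∧ χ (b e) = t) =
      F1.filter (fun e => χ (a e) = t ∧ χ (b e) = t) := by
    ext e
    rw [Finset.mem_filter, Finset.mem_filter, hm]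
    constructor
    · rintro ⟨h | h | h, h'⟩
      · exact absurd h' (hncut e h t)
      · exact h
      · exact absurd (h.2.1.symm.trans h'.1) hst
    · intro h
      exact ⟨Or.inr (Or.inl h), h.2⟩
  have hfs : F.filter (fun e => χ (a e) = s ∧ χ (b e) = s) =
      F2.filter (fun e => χ (a e) = s ∧ χ (b e) = s) := by
    ext e
    rw [Finset.mem_filter, Finset.mem_filter, hm]
    constructor
    · rintro ⟨h | h | h, h'⟩
      · exact absurd h' (hncut e h s)
      · exact absurd (h.2.1.symm.trans h'.1) hst.symm
      · exact h
    · intro h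
      exact ⟨Or.inr (Or.inr h), h.2⟩
  refine ⟨F, hgF, hgF', fun e he h1 h2 => (hm e).2 (Or.inr (Or.inl ⟨he, h1, h2⟩)),
    fun e he h1 h2 => (hm e).2 (Or.inr (Or.inr ⟨he, h1, h2⟩)), ?_, ?_⟩
  · intro ψ
    rw [sum_split a b χ g g' hgg hcut hst, hft, hfs, if_pos hgF, if_pos hgF']
    have s1 := con_sum a b χ g g' hgg hcut hst x0 F1 hF1 ψ
    have s2 := con_sum a b χ g g' hgg hcut hst.symm y0 F2 hF2 ψ
    rw [if_pos hg1, if_pos hg1'] at s1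
    rw [if_pos hg2, if_pos hg2'] at s2
    have key : ∀ e, (e = g ∨ e = g') → dd a b ψ e +
        dd (con χ s x0 ∘ a) (con χ s x0 ∘ b) ψ e + dd (con χ t y0 ∘ a) (con χ t y0 ∘ b) ψ e
        = ψ x0 + ψ y0 := by
      intro e he
      have h1 : χ (a e) ≠ χ (b e) := fun h => (hcut e).2 he (z2eq.2 h)
      simp only [dd, Function.comp]
      rcases z2two hst (χ (a e)) with h | h
      · have hb : χ (b e) = t := (z2two hst (χ (b e))).resolve_left fun h' => h1 (h.trans h'.symm)
        rw [con_pos h, con_neg (s := t) (by rw [h]; exact hst), con_pos hb,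
          con_neg (s := s) (by rw [hb]; exact hst.symm)]
        have e1 := z2add (ψ (a e))
        have e2 := z2add (ψ (b e))
        linear_combination e1 + e2
      · have hb : χ (b e) = s := (z2two hst (χ (b e))).resolve_right fun h' => h1 (h.trans h'.symm)
        rw [con_pos h, con_neg (s := s) (by rw [h]; exact hst.symm), con_pos hb,
          con_neg (s := t) (by rw [hb]; exact hst)]
        have e1 := z2add (ψ (a e))
        have e2 := z2add (ψ (b e))
        linear_combination e1 + e2
    have k1 := key g (Or.inl rfl)
    have k2 := key g' (Or.inr rfl)
    have k3 := z2add (ψ x0)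
    have k4 := z2add (ψ y0)
    have k5 := z2add (∑ e ∈ F1.filter (fun e => χ (a e) = t ∧ χ (b e) = t), dd a b ψ e)
    have k6 := z2add (∑ e ∈ F2.filter (fun e => χ (a e) = s ∧ χ (b e) = s), dd a b ψ e)
    linear_combination k1 + k2 + k3 + k4 + k5 + k6 - s1 - s2
  · intro ψ hψ
    have p1 := con_half a b χ g g' hgg hcut hst x0 hx0 F1 hF1 hFc1 hg1 ψ (hψ g hgF) (hψ g' hgF')
      (fun e he h1 h2 => hψ e ((hm e).2 (Or.inr (Or.inl ⟨he, h1, h2⟩))))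
    have p2 := con_half a b χ g g' hgg hcut hst.symm y0 hy0 F2 hF2 hFc2 hg2 ψ (hψ g hgF)
      (hψ g' hgF') (fun e he h1 h2 => hψ e ((hm e).2 (Or.inr (Or.inr ⟨he, h1, h2⟩))))
    refine ⟨ψ (a g), fun e he => ?_⟩
    rcases (hm e).1 he with (rfl | rfl) | h | h
    · rfl
    · exact p1.1
    · exact p1.2 e h.1 h.2.1 h.2.2
    · exact p2.2 e h.1 h.2.1 h.2.2

/-- The uncut case. -/
theorem unglue [DecidableEq E] (a b : E → V) (χ : V → ZMod 2) (g g' : E) (hgg : g ≠ g')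
    (hcut : ∀ e, dd a b χ e ≠ 0 ↔ e = g ∨ e = g') {s t : ZMod 2} (hst : s ≠ t)
    (x0 : V) (F : Finset E)
    (hF : EvenF (con χ s x0 ∘ a) (con χ s x0 ∘ b) F)
    (hFc : ConnF (con χ s x0 ∘ a) (con χ s x0 ∘ b) F) (hg : g ∉ F) (hg' : g' ∉ F) :
    EvenF a b (F.filter (fun e => χ (a e) = t ∧ χ (b e) = t)) ∧
    ConnF a b (F.filter (fun e => χ (a e) = t ∧ χ (b e) = t)) := by
  constructor
  · intro ψ
    have := con_sum a b χ g g' hgg hcut hst x0 F hF ψ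
    rw [if_neg hg, if_neg hg', zero_add, zero_add] at this
    exact this
  · intro ψ hψ
    have hn : ∀ v, χ v = t → con χ s x0 v = v := fun v h => con_neg (by rw [h]; exact hst.symm)
    obtain ⟨c, hc⟩ := hFc ψ (by
      intro e he
      have hc : dd a b χ e = 0 := by
        by_contra h
        rcases (hcut e).1 h with rfl | rfl
        · exact hg he
        · exact hg' he
      have hab := z2eq.1 hc
      simp only [dd, Function.comp]
      rcases z2two hst (χ (a e)) with h | h
      · rw [con_pos h, con_pos (hab ▸ h), z2add]
      · rw [hn _ h, hn _ (hab ▸ h)]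
        exact hψ e (Finset.mem_filter.2 ⟨he, h, hab ▸ h⟩))
    refine ⟨c, fun e he => ?_⟩
    have h := Finset.mem_filter.1 he
    have := hc e h.1
    simp only [Function.comp, hn _ h.2.1] at this
    exact this

/-- A vertex of degree two. -/
theorem single [Fintype E] [DecidableEq E] (a b : E → V) (x : V) (g g' : E) (hgg : g ≠ g')
    (hcut : ∀ e, (¬ (a e = x ↔ b e = x)) ↔ e = g ∨ e = g') (m : ℕ)
    (ih : ∀ f : V → V, ¬ Function.Surjective f → ∀ S : Finset E, S.card ≤ m →
      ∃ F, S ⊆ F ∧ EvenF (f ∘ a) (f ∘ b) F ∧ ConnF (f ∘ a) (f ∘ b) F)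
    (S : Finset E) (hS : S.card ≤ m) : ∃ F, S ⊆ F ∧ EvenF a b F ∧ ConnF a b F := by
  classical
  let T : E → Prop := fun e => a e = x ∨ b e = x
  have hcg := (hcut g).2 (Or.inl rfl)
  have hcg' := (hcut g').2 (Or.inr rfl)
  have hgT : T g := by simp only [T]; tauto
  have hgT' : T g' := by simp only [T]; tauto
  let y := if a g = x then b g else a g
  have hyx : y ≠ x := by
    simp only [y]; split_ifs with h <;> tauto
  let f : V → V := fun v => if v = x then y else v
  have hfx : f x = y := if_pos rfl
  have hfn : ∀ v, v ≠ x → f v = v := fun v h => if_neg h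
  have hf : ¬ Function.Surjective f := by
    intro h
    obtain ⟨v, hv⟩ := h x
    by_cases hvx : v = x
    · rw [hvx, hfx] at hv; exact hyx hv
    · rw [hfn v hvx] at hv; exact hvx hv
  have hloop : ∀ e, T e → e ≠ g → e ≠ g' → a e = x ∧ b e = x := by
    intro e he h1 h2
    have := hcut e
    simp only [T] at he
    tauto
  have hdl : ∀ (ψ : V → ZMod 2) e, T e → e ≠ g → e ≠ g' → dd a b ψ e = 0 := by
    intro ψ e he h1 h2
    have := hloop e he h1 h2
    rw [dd, this.1, this.2, z2add]
  have hdfl : ∀ (ψ : V → ZMod 2) e, T e → e ≠ g' → dd (f ∘ a) (f ∘ b) ψ e = 0 := by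
    intro ψ e he h2
    by_cases h1 : e = g
    · subst h1
      have : f (a e) = f (b e) := by
        by_cases h : a e = x
        · have hb : b e ≠ x := by tauto
          rw [h, hfx, hfn _ hb]; simp only [y, if_pos h]
        · have hb : b e = x := by tauto
          rw [hb, hfx, hfn _ h]; simp only [y, if_neg h]
      simp only [dd, Function.comp, this, z2add]
    · have := hloop e he h1 h2
      simp only [dd, Function.comp, this.1, this.2, z2add]
  have hdn : ∀ (ψ : V → ZMod 2) e, ¬ T e → dd (f ∘ a) (f ∘ b) ψ e = dd a b ψ e := by
    intro ψ e he
    simp only [T, not_or] at he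
    simp only [dd, Function.comp, hfn _ he.1, hfn _ he.2]
  have hg1 : ∀ ψ : V → ZMod 2, dd a b ψ g = ψ x + ψ y := by
    intro ψ
    by_cases h : a g = x
    · simp only [dd, y, if_pos h]; rw [h]
    · have hb : b g = x := by tauto
      simp only [dd, y, if_neg h]; rw [hb, add_comm]
  have hg2 : ∀ ψ : V → ZMod 2, dd (f ∘ a) (f ∘ b) ψ g' = dd a b ψ g + dd a b ψ g' := by
    intro ψ
    rw [hg1]
    have e1 := z2add (ψ x)
    by_cases h : a g' = x
    · have hb : b g' ≠ x := by tauto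
      simp only [dd, Function.comp, h, hfx, hfn _ hb]
      linear_combination -e1
    · have hb : b g' = x := by tauto
      simp only [dd, Function.comp, hb, hfx, hfn _ h]
      linear_combination -e1
  obtain ⟨S1, hS1c, hS1a, hS1b⟩ : ∃ S1 : Finset E, S1.card ≤ m ∧ (∀ e ∈ S, ¬ T e → e ∈ S1) ∧
      ((∃ e ∈ S, T e) → g' ∈ S1) := by
    by_cases h : ∃ e ∈ S, T e
    · obtain ⟨e, he, heT⟩ := h
      refine ⟨insert g' (S.filter fun e => ¬ T e), ?_, ?_, ?_⟩
      · have h1 : (S.filter fun e => ¬ T e) ⊂ S := by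
          rw [Finset.filter_ssubset]
          exact ⟨e, he, by simpa using heT⟩
        have h2 := Finset.card_lt_card h1
        have h3 := Finset.card_insert_le g' (S.filter fun e => ¬ T e)
        omega
      · intro e he heT
        exact Finset.mem_insert_of_mem (Finset.mem_filter.2 ⟨he, heT⟩)
      · intro _; exact Finset.mem_insert_self _ _
    · exact ⟨S, hS, fun e he _ => he, fun h' => absurd h' h⟩
  obtain ⟨F1, hSF, hFe, hFc⟩ := ih f hf S1 hS1c
  have hsplit : ∀ ψ : V → ZMod 2, ∑ e ∈ F1.filter (fun e => ¬ T e), dd a b ψ e +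
      (if g' ∈ F1 then dd a b ψ g + dd a b ψ g' else 0) = 0 := by
    intro ψ
    have h := hFe ψ
    rw [← Finset.sum_filter_add_sum_filter_not F1 T, add_comm] at h
    refine Eq.trans ?_ h
    congr 1
    · apply Finset.sum_congr rfl
      intro e he
      exact (hdn ψ e (Finset.mem_filter.1 he).2).symm
    · rw [← hg2]
      split_ifs with hgF
      · symm
        apply Finset.sum_eq_single
        · intro e he hne
          exact hdfl ψ e (Finset.mem_filter.1 he).2 hne
        · intro h
          exact absurd (Finset.mem_filter.2 ⟨hgF, hgT'⟩) h
      · symm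
        apply Finset.sum_eq_zero
        intro e he
        have := Finset.mem_filter.1 he
        exact hdfl ψ e this.2 (fun h => hgF (h ▸ this.1))
  by_cases hgF : g' ∈ F1
  · refine ⟨F1.filter (fun e => ¬ T e) ∪ Finset.univ.filter T, ?_, ?_, ?_⟩
    · intro e he
      by_cases heT : T e
      · simp [heT]
      · simp [heT, hSF (hS1a e he heT)]
    · intro ψ
      have h := hsplit ψ
      rw [if_pos hgF] at h
      rw [← h, Finset.sum_union]
      · congr 1
        rw [← Finset.sum_pair hgg]
        symm
        apply Finset.sum_subset
        · intro e he
          rw [Finset.mem_insert, Finset.mem_singleton] at he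
          rcases he with rfl | rfl
          · simp [hgT]
          · simp [hgT']
        · intro e he hne
          simp only [Finset.mem_insert, Finset.mem_singleton, not_or] at hne
          exact hdl ψ e (Finset.mem_filter.1 he).2 hne.1 hne.2
      · rw [Finset.disjoint_left]
        intro e he he'
        exact (Finset.mem_filter.1 he).2 (Finset.mem_filter.1 he').2
    · intro ψ hψ
      have hT : ∀ e, T e → dd a b ψ e = 0 := fun e he => hψ e (by simp [he])
      have hxy : ψ y = ψ x := by
        have := hT g hgT
        rw [hg1] at this
        exact (z2eq.1 this).symm
      have hψf : ∀ v, ψ (f v) = ψ v := by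
        intro v
        by_cases h : v = x
        · rw [h, hfx, hxy]
        · rw [hfn v h]
      have hψd : ∀ e, dd (f ∘ a) (f ∘ b) ψ e = dd a b ψ e := by
        intro e; simp only [dd, Function.comp, hψf]
      have hk : ∀ e ∈ F1, dd (f ∘ a) (f ∘ b) ψ e = 0 := by
        intro e he
        rw [hψd]
        by_cases heT : T e
        · exact hT e heT
        · exact hψ e (by simp [he, heT])
      obtain ⟨c, hc⟩ := hFc ψ hk
      simp only [Function.comp, hψf] at hc
      have hTx : ∀ e, T e → ψ (a e) = ψ x := by
        intro e he
        have h1 := z2eq.1 (hT e he)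
        rcases he with h | h
        · rw [h]
        · rw [h1, h]
      refine ⟨c, fun e he => ?_⟩
      by_cases heT : T e
      · rw [hTx e heT, ← hTx g' hgT', hc g' hgF]
      · apply hc
        simpa [heT] using he
  · refine ⟨F1.filter (fun e => ¬ T e), ?_, ?_, ?_⟩
    · intro e he
      have heT : ¬ T e := fun h => hgF (hSF (hS1b ⟨e, he, h⟩))
      simp [heT, hSF (hS1a e he heT)]
    · intro ψ
      have h := hsplit ψ
      rw [if_neg hgF, add_zero] at h
      exact h
    · intro ψ hψ
      obtain ⟨c, hc⟩ := hFc ψ (by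
        intro e he
        by_cases heT : T e
        · exact hdfl ψ e heT (fun h => hgF (h ▸ he))
        · rw [hdn ψ e heT]
          exact hψ e (Finset.mem_filter.2 ⟨he, heT⟩))
      refine ⟨c, fun e he => ?_⟩
      have h := Finset.mem_filter.1 he
      rw [← hc e h.1]
      have h2 : a e ≠ x := fun h' => h.2 (Or.inl h')
      simp only [Function.comp, hfn _ h2]

theorem indmain {E : Type*} [Fintype E] [DecidableEq E] (m : ℕ) (hm : 3 ≤ m) :
    ∀ (n : ℕ) (V : Type u) [Fintype V] (a b : E → V), Fintype.card V ≤ n →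
      Spans a b Finset.univ → NoOdd a b m → ∀ S : Finset E, S.card ≤ m →
      ∃ F, S ⊆ F ∧ EvenF a b F ∧ ConnF a b F := by
  intro n
  induction n with
  | zero =>
    intro V _ a b hV hsp hno S hS
    have : IsEmpty V := Fintype.card_eq_zero_iff.1 (by omega)
    have hE : IsEmpty E := ⟨fun e => this.elim (a e)⟩
    exact ⟨S, Finset.Subset.refl _, fun χ => Finset.sum_eq_zero fun e => hE.elim e,
      fun χ _ => ⟨0, fun e => hE.elim e⟩⟩
  | succ n IH =>
    intro V _ a b hV hsp hno S hS
    classical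
    rcases isEmpty_or_nonempty V with hVe | hVn
    · exact IH V a b (by rw [Fintype.card_eq_zero]; omega) hsp hno S hS
    have ih : ∀ f : V → V, ¬ Function.Surjective f → ∀ S : Finset E, S.card ≤ m →
        ∃ F, S ⊆ F ∧ EvenF (f ∘ a) (f ∘ b) F ∧ ConnF (f ∘ a) (f ∘ b) F := by
      intro f hf S hS
      have hcard : Fintype.card (Set.range f) ≤ n := by
        have h1 : Fintype.card (Set.range f) < Fintype.card V := by
          simp only [Function.Surjective] at hf
          push Not at hf
          obtain ⟨v, hv⟩ := hf
          exact Fintype.card_subtype_lt (x := v) (by rintro ⟨w, hw⟩; exact hv w hw)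
        omega
      obtain ⟨F, h1, h2, h3⟩ := IH (Set.range f) (Set.rangeFactorization f ∘ a)
        (Set.rangeFactorization f ∘ b) hcard (by
          intro χ hχ
          obtain ⟨c, hc⟩ := hsp (χ ∘ Set.rangeFactorization f) hχ
          refine ⟨c, ?_⟩
          rintro ⟨_, v, rfl⟩
          exact hc v) (hno.comp _) S hS
      exact ⟨F, h1, h2.comp Subtype.val, fun χ hχ => h3 (χ ∘ Subtype.val) hχ⟩
    by_cases h4 : ∀ χ : V → ZMod 2, (∃ v w, χ v ≠ χ w) → 4 ≤ (cutF a b χ).card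
    · obtain ⟨F, h1, h2, h3⟩ := main4 a b m hm hsp h4 hno S hS
      exact ⟨F, h1, h2, h3.conn⟩
    push Not at h4
    obtain ⟨χ, ⟨v0, w0, hvw⟩, hlt⟩ := h4
    have hodd : ¬ Odd (cutF a b χ).card := by
      intro h
      have := hno χ h
      omega
    have hne0 : (cutF a b χ).card ≠ 0 := by
      intro h
      rw [Finset.card_eq_zero] at h
      obtain ⟨c, hc⟩ := hsp χ (by
        intro e _
        by_contra he
        have := (mem_cutF a b χ e).2 he
        rw [h] at this
        simp at this)
      exact hvw ((hc v0).trans (hc w0).symm)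
    have h2 : (cutF a b χ).card = 2 := by
      rw [Nat.not_odd_iff_even] at hodd
      obtain ⟨r, hr⟩ := hodd
      omega
    obtain ⟨g, g', hgg, hgc⟩ := Finset.card_eq_two.1 h2
    have hcut : ∀ e, dd a b χ e ≠ 0 ↔ e = g ∨ e = g' := by
      intro e
      rw [← mem_cutF, hgc, Finset.mem_insert, Finset.mem_singleton]
    by_cases hsing : ∃ s x, ∀ v, χ v = s ↔ v = x
    · obtain ⟨s, x, hx⟩ := hsing
      refine single a b x g g' hgg ?_ m ih S hS
      intro e
      rw [← hcut, ← hx, ← hx, dd, Ne, z2eq]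
      have : ∀ p q s : ZMod 2, ¬ (p = s ↔ q = s) ↔ ¬ p = q := by decide
      exact this _ _ _
    push Not at hsing
    have hval : ∀ s, ∃ x, χ x = s := by
      intro s
      rcases z2two hvw s with h | h
      · exact ⟨v0, h.symm⟩
      · exact ⟨w0, h.symm⟩
    have hcon : ∀ s, ∃ x0, χ x0 = s ∧ ¬ Function.Surjective (con χ s x0) := by
      intro s
      obtain ⟨x0, hx0⟩ := hval s
      refine ⟨x0, hx0, fun hsur => ?_⟩
      rcases hsing s x0 with ⟨v, ⟨hv, hvx⟩ | ⟨hv, hvx⟩⟩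
      · obtain ⟨u, hu⟩ := hsur v
        by_cases huu : χ u = s
        · rw [con_pos huu] at hu; exact hvx hu.symm
        · rw [con_neg huu] at hu; rw [hu] at huu; exact huu hv
      · exact hv (hvx ▸ hx0)
    have htri : ∀ s t : ZMod 2, s ≠ t → ∀ e, (e = g ∨ e = g') ∨ (χ (a e) = s ∧ χ (b e) = s) ∨
        (χ (a e) = t ∧ χ (b e) = t) := by
      intro s t hst e
      by_cases hc : dd a b χ e = 0
      · have hab := z2eq.1 hc
        rcases z2two hst (χ (a e)) with h | h
        · exact Or.inr (Or.inl ⟨h, hab ▸ h⟩)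
        · exact Or.inr (Or.inr ⟨h, hab ▸ h⟩)
      · exact Or.inl ((hcut e).1 hc)
    by_cases hB : ∃ s, ∀ e ∈ S, ¬ (χ (a e) = s ∧ χ (b e) = s)
    · obtain ⟨s, hs⟩ := hB
      have hst : s ≠ s + 1 := (by decide : ∀ s : ZMod 2, s ≠ s + 1) s
      obtain ⟨x0, hx0, hsur⟩ := hcon s
      obtain ⟨y0, hy0, _⟩ := hcon (s + 1)
      obtain ⟨F1, hSF, hF1, hFc1⟩ := ih _ hsur S hS
      by_cases hgF : g ∈ F1
      · obtain ⟨F2, hgF2, hF2, hFc2⟩ := L1 (con χ (s + 1) y0 ∘ a) (con χ (s + 1) y0 ∘ b)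
          ((hno.mono (by omega)).comp _) g
        obtain ⟨F, k1, k2, k3, k4, k5⟩ := glue a b χ g g' hgg hcut hst x0 hx0 y0 hy0 F1 F2 hF1 hFc1
          hgF hF2 hFc2 hgF2
        refine ⟨F, fun e he => ?_, k5⟩
        rcases htri _ _ hst e with (rfl | rfl) | h | h
        · exact k1
        · exact k2
        · exact absurd h (hs e he)
        · exact k3 e (hSF he) h.1 h.2
      · have hgF' : g' ∉ F1 := fun h => hgF (par a b χ g' g hgg.symm
          (fun e => (hcut e).trans or_comm) F1 (con_even_chi hx0 hF1) h)
        refine ⟨_, ?_, unglue a b χ g g' hgg hcut hst x0 F1 hF1 hFc1 hgF hgF'⟩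
        intro e he
        rcases htri _ _ hst e with (rfl | rfl) | h | h
        · exact absurd (hSF he) hgF
        · exact absurd (hSF he) hgF'
        · exact absurd h (hs e he)
        · exact Finset.mem_filter.2 ⟨hSF he, h⟩
    · push Not at hB
      have hA : ∀ s, ∃ x0, χ x0 = s ∧ ∃ F, (∀ e ∈ S, ¬ (χ (a e) = s ∧ χ (b e) = s) → e ∈ F) ∧
          g ∈ F ∧ EvenF (con χ s x0 ∘ a) (con χ s x0 ∘ b) F ∧
          ConnF (con χ s x0 ∘ a) (con χ s x0 ∘ b) F := by
        intro s
        obtain ⟨x0, hx0, hsur⟩ := hcon s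
        obtain ⟨e, he, hes⟩ := hB s
        obtain ⟨F, hSF, hF, hFc⟩ := ih _ hsur
          (insert g (S.filter fun e => ¬ (χ (a e) = s ∧ χ (b e) = s))) (by
            have h1 : (S.filter fun e => ¬ (χ (a e) = s ∧ χ (b e) = s)) ⊂ S := by
              rw [Finset.filter_ssubset]
              exact ⟨e, he, not_not.2 hes⟩
            have h2 := Finset.card_lt_card h1
            have h3 := Finset.card_insert_le g
              (S.filter fun e => ¬ (χ (a e) = s ∧ χ (b e) = s))
            omega)
        exact ⟨x0, hx0, F, fun e he h => hSF (Finset.mem_insert_of_mem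
          (Finset.mem_filter.2 ⟨he, h⟩)), hSF (Finset.mem_insert_self _ _), hF, hFc⟩
      obtain ⟨x0, hx0, F1, hS1, hg1, hF1, hFc1⟩ := hA 0
      obtain ⟨y0, hy0, F2, hS2, hg2, hF2, hFc2⟩ := hA 1
      have hst : (0 : ZMod 2) ≠ 1 := zero_ne_one
      obtain ⟨F, k1, k2, k3, k4, k5⟩ := glue a b χ g g' hgg hcut hst x0 hx0 y0 hy0 F1 F2 hF1 hFc1
          hg1 hF2 hFc2 hg2
      refine ⟨F, fun e he => ?_, k5⟩
      rcases htri _ _ hst e with (rfl | rfl) | h | h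
      · exact k1
      · exact k2
      · exact k4 e (hS2 e he fun h' => hst (h.1.symm.trans h'.1)) h.1 h.2
      · exact k3 e (hS1 e he fun h' => hst (h'.1.symm.trans h.1)) h.1 h.2

end ind

section graph
variable {V : Type u} {G : SimpleGraph V}

/-- Coboundary on unordered pairs. -/
def dl (χ : V → ZMod 2) : Sym2 V → ZMod 2 :=
  Sym2.lift ⟨fun x y => χ x + χ y, fun x y => add_comm _ _⟩

theorem walk_sum (χ : V → ZMod 2) {u v : V} (p : G.Walk u v) :
    (p.edges.map (dl χ)).sum = χ u + χ v := by
  induction p with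
  | nil => simp [z2add]
  | cons h p ih =>
    rename_i x y z
    rw [SimpleGraph.Walk.edges_cons, List.map_cons, List.sum_cons, ih]
    have e1 := z2add (χ y)
    simp only [dl, Sym2.lift_mk]
    linear_combination e1

theorem trail_sum [Fintype G.edgeSet] [DecidableEq V] (a b : G.edgeSet → V)
    (hab : ∀ e, s(a e, b e) = e.1)
    (χ : V → ZMod 2) {u v : V} (p : G.Walk u v) (hp : p.IsTrail) :
    ∑ e ∈ Finset.univ.filter (fun e : G.edgeSet => e.1 ∈ p.edges), dd a b χ e = χ u + χ v := by
  rw [← walk_sum χ p, ← List.sum_toFinset _ hp.edges_nodup]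
  have h1 : p.edges.toFinset = (Finset.univ.filter
      (fun e : G.edgeSet => e.1 ∈ p.edges)).map (Function.Embedding.subtype _) := by
    ext e
    simp only [List.mem_toFinset, Finset.mem_map, Finset.mem_filter, Finset.mem_univ, true_and,
      Function.Embedding.subtype_apply]
    constructor
    · intro h
      exact ⟨⟨e, p.edges_subset_edgeSet h⟩, h, rfl⟩
    · rintro ⟨f, hf, rfl⟩; exact hf
  rw [h1, Finset.sum_map]
  apply Finset.sum_congr rfl
  intro e _
  simp only [Function.Embedding.subtype_apply, ← hab, dl, Sym2.lift_mk, dd]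

theorem euler [Fintype G.edgeSet] [DecidableEq V] (a b : G.edgeSet → V)
    (hab : ∀ e, s(a e, b e) = e.1) (F : Finset G.edgeSet) (hne : F.Nonempty)
    (hF : EvenF a b F) (hFc : ConnF a b F) :
    ∃ (x : V) (c : G.Walk x x), c.IsCircuit ∧ ∀ e ∈ F, e.1 ∈ c.edges := by
  classical
  let P : Set ℕ := {n | ∃ (u v : V) (p : G.Walk u v), p.IsTrail ∧
    (∀ e ∈ p.edges, ∃ f ∈ F, f.1 = e) ∧ p.length = n}
  have h1 : 1 ∈ P := by
    obtain ⟨e, he⟩ := hne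
    have hadj : G.Adj (a e) (b e) := by
      rw [← SimpleGraph.mem_edgeSet, hab]; exact e.2
    refine ⟨a e, b e, hadj.toWalk, ?_, ?_, ?_⟩
    · simp [SimpleGraph.Walk.isTrail_def]
    · intro f hf
      refine ⟨e, he, ?_⟩
      simp at hf
      rw [hf, hab]
    · simp
  have hbd : BddAbove P := by
    refine ⟨F.card, ?_⟩
    rintro _ ⟨u, v, p, hp, hpF, rfl⟩
    rw [← SimpleGraph.Walk.length_edges, ← List.toFinset_card_of_nodup hp.edges_nodup]
    have : p.edges.toFinset ⊆ F.image Subtype.val := by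
      intro e he
      obtain ⟨f, hf, rfl⟩ := hpF e (List.mem_toFinset.1 he)
      exact Finset.mem_image_of_mem _ hf
    exact (Finset.card_le_card this).trans Finset.card_image_le
  obtain ⟨u, v, p, hp, hpF, hpl⟩ := Nat.sSup_mem ⟨1, h1⟩ hbd
  have hmax : ∀ n ∈ P, n ≤ p.length := fun n hn => by rw [hpl]; exact le_csSup hbd hn
  clear hpl
  have hpos : 1 ≤ p.length := hmax 1 h1
  have ext : ∀ (u v : V) (q : G.Walk u v), q.IsTrail → (∀ e ∈ q.edges, ∃ f ∈ F, f.1 = e) →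
      q.length = p.length → ∀ f ∈ F, v ∈ f.1 → f.1 ∈ q.edges := by
    intro u v q hq hqF hql f hf hv
    by_contra hnot
    obtain ⟨w, hw⟩ := Sym2.mem_iff_exists.1 hv
    have hadj : G.Adj w v := by
      rw [← SimpleGraph.mem_edgeSet, Sym2.eq_swap, ← hw]; exact f.2
    have hrev : G.Adj v w := hadj.symm
    have : q.length + 1 ∈ P := by
      refine ⟨w, u, SimpleGraph.Walk.cons hadj q.reverse, ?_, ?_, ?_⟩
      · rw [SimpleGraph.Walk.isTrail_cons]
        refine ⟨hq.reverse, ?_⟩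
        rw [SimpleGraph.Walk.edges_reverse, List.mem_reverse, Sym2.eq_swap, ← hw]
        exact hnot
      · intro e he
        rw [SimpleGraph.Walk.edges_cons, List.mem_cons, SimpleGraph.Walk.edges_reverse,
          List.mem_reverse] at he
        rcases he with rfl | he
        · exact ⟨f, hf, by rw [hw, Sym2.eq_swap]⟩
        · exact hqF e he
      · simp
    have := hmax _ this
    omega
  have hsub : (Finset.univ.filter (fun e : G.edgeSet => e.1 ∈ p.edges)) ⊆ F := by
    intro e he
    obtain ⟨f, hf, hfe⟩ := hpF e.1 (Finset.mem_filter.1 he).2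
    rwa [← Subtype.ext hfe]
  have hma : ∀ f : G.edgeSet, a f ∈ f.1 := fun f => by rw [← hab]; exact Sym2.mem_mk_left _ _
  have hmb : ∀ f : G.edgeSet, b f ∈ f.1 := fun f => by rw [← hab]; exact Sym2.mem_mk_right _ _
  have huv : u = v := by
    by_contra huv
    let χ : V → ZMod 2 := fun x => if x = v then 1 else 0
    have h2 := trail_sum a b hab χ p hp
    rw [Finset.sum_subset hsub, hF χ] at h2
    · simp [χ, huv] at h2
    · intro e he hne
      have hv : v ∉ e.1 := fun h => hne (Finset.mem_filter.2
        ⟨Finset.mem_univ _, ext u v p hp hpF rfl e he h⟩)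
      have ha : a e ≠ v := fun h => hv (h ▸ hma e)
      have hb : b e ≠ v := fun h => hv (h ▸ hmb e)
      simp [dd, χ, ha, hb]
  subst huv
  have hrot : ∀ f ∈ F, ∀ w, w ∈ f.1 → w ∈ p.support → f.1 ∈ p.edges := by
    intro f hf w hw hws
    have hr := p.rotate_edges w hws
    have hmem : ∀ e, e ∈ (p.rotate w hws).edges ↔ e ∈ p.edges := fun e => hr.mem_iff
    rw [← hmem]
    refine ext w w (p.rotate w hws) (hp.rotate hws) ?_ ?_ f hf hw
    · intro e he
      exact hpF e ((hmem e).1 he)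
    · rw [← SimpleGraph.Walk.length_edges, ← SimpleGraph.Walk.length_edges]
      exact hr.perm.length_eq
  have hsup : ∀ f : G.edgeSet, f.1 ∈ p.edges → a f ∈ p.support ∧ b f ∈ p.support := by
    intro f hf
    rw [← hab] at hf
    exact ⟨p.fst_mem_support_of_mem_edges hf, p.snd_mem_support_of_mem_edges hf⟩
  let ψ : V → ZMod 2 := fun x => if x ∈ p.support then 1 else 0
  obtain ⟨c, hc⟩ := hFc ψ (by
    intro f hf
    by_cases hfp : f.1 ∈ p.edges
    · have := hsup f hfp
      simp only [dd, ψ, if_pos this.1, if_pos this.2, z2add]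
    · have h2 : a f ∉ p.support := fun h => hfp (hrot f hf _ (hma f) h)
      have h3 : b f ∉ p.support := fun h => hfp (hrot f hf _ (hmb f) h)
      simp only [dd, ψ, if_neg h2, if_neg h3, z2add])
  obtain ⟨e0, he0⟩ : ∃ e0, e0 ∈ p.edges := by
    apply List.exists_mem_of_length_pos
    rw [SimpleGraph.Walk.length_edges]; omega
  obtain ⟨f0, hf0, rfl⟩ := hpF e0 he0
  refine ⟨u, p, ⟨hp, ?_⟩, ?_⟩
  · rintro rfl
    simp at hpos
  · intro f hf
    apply hrot f hf _ (hma f)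
    by_contra hns
    have h2 := (hc f hf).trans (hc f0 hf0).symm
    simp only [ψ, if_neg hns, if_pos (hsup f0 he0).1] at h2
    exact zero_ne_one h2

theorem spans_of_connected [Fintype G.edgeSet] (hG : G.Connected) (a b : G.edgeSet → V)
    (hab : ∀ e, s(a e, b e) = e.1) : Spans a b Finset.univ := by
  intro χ hχ
  have hadj : ∀ x y, G.Adj x y → χ x = χ y := by
    intro x y hxy
    have h1 := hχ ⟨s(x, y), hxy⟩ (Finset.mem_univ _)
    have h2 := hab ⟨s(x, y), hxy⟩
    rw [dd, z2eq] at h1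
    rcases Sym2.eq_iff.1 h2 with h | h
    · rw [h.1, h.2] at h1; exact h1
    · rw [h.1, h.2] at h1; exact h1.symm
  have hw : ∀ {x y : V} (p : G.Walk x y), χ x = χ y := by
    intro x y p
    induction p with
    | nil => rfl
    | cons h p ih => exact (hadj _ _ h).trans ih
  obtain ⟨v⟩ := hG.nonempty
  refine ⟨χ v, fun w => ?_⟩
  obtain ⟨p⟩ := hG.preconnected w v
  exact hw p

theorem final [Fintype V] (hG : G.Connected) (k : ℕ) (hk : 1 ≤ k)
    (h : ∀ S : Set (Sym2 V), S ⊆ G.edgeSet → S.ncard = 2 * k - 1 →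
      ∃ (x : V) (c : G.Walk x x), c.IsCircuit ∧ ∀ e ∈ S, e ∈ c.edges)
    (S : Set (Sym2 V)) (hSE : S ⊆ G.edgeSet) (hS : S.ncard = 2 * k) :
    ∃ (x : V) (c : G.Walk x x), c.IsCircuit ∧ ∀ e ∈ S, e ∈ c.edges := by
  classical
  have hex : ∀ e : G.edgeSet, ∃ x y, s(x, y) = e.1 := by
    rintro ⟨e, he⟩
    induction e using Sym2.ind with
    | _ x y => exact ⟨x, y, rfl⟩
  choose a b hab using hex
  have hval : ∀ T : Finset G.edgeSet, (Subtype.val '' (T : Set G.edgeSet)).ncard = T.card := by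
    intro T
    rw [Set.ncard_image_of_injective _ Subtype.val_injective, Set.ncard_coe_finset]
  let S' : Finset G.edgeSet := Finset.univ.filter fun e => e.1 ∈ S
  have hS' : Subtype.val '' (S' : Set G.edgeSet) = S := by
    ext e
    constructor
    · rintro ⟨f, hf, rfl⟩
      simpa [S'] using hf
    · intro he
      exact ⟨⟨e, hSE he⟩, by simpa [S'] using he, rfl⟩
  have hcard : S'.card = 2 * k := by rw [← hval, hS', hS]
  have hno : NoOdd a b (2 * k) := by
    intro χ hodd
    by_contra hle
    push Not at hle
    have hle' : (cutF a b χ).card ≤ 2 * k - 1 := by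
      obtain ⟨r, hr⟩ := hodd
      omega
    have huniv : S'.card ≤ (Finset.univ : Finset G.edgeSet).card :=
      Finset.card_le_card (Finset.subset_univ _)
    obtain ⟨T, hT1, _, hT3⟩ := Finset.exists_subsuperset_card_eq
      (Finset.subset_univ (cutF a b χ)) hle' (by omega)
    obtain ⟨x, c, hc, hcT⟩ := h (Subtype.val '' (T : Set G.edgeSet))
      (by rintro _ ⟨f, _, rfl⟩; exact f.2) (by rw [hval, hT3])
    have hsum := trail_sum a b hab χ c hc.isTrail
    rw [z2add, Finset.sum_subset (Finset.subset_univ _), sum_univ_eq_card] at hsum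
    · exact (odd_iff_cast _).1 hodd hsum
    · intro e _ he
      by_contra hne
      apply he
      refine Finset.mem_filter.2 ⟨Finset.mem_univ _, hcT _ ⟨e, ?_, rfl⟩⟩
      exact_mod_cast hT1 ((mem_cutF a b χ e).2 hne)
  have hsp := spans_of_connected hG a b hab
  have hmain : ∃ F, S' ⊆ F ∧ EvenF a b F ∧ ConnF a b F := by
    by_cases hk1 : k = 1
    · subst hk1
      obtain ⟨e, q, _, heq⟩ := Finset.card_eq_two.1 hcard
      obtain ⟨F, h1, h2, h3⟩ := L2 a b (hno.mono (by omega)) hsp e q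
      refine ⟨F, ?_, h3⟩
      rw [heq]
      intro f hf
      rw [Finset.mem_insert, Finset.mem_singleton] at hf
      rcases hf with rfl | rfl
      · exact h1
      · exact h2
    · exact indmain (2 * k) (by omega) _ V a b le_rfl hsp hno S' hcard.le
  obtain ⟨F, hSF, hF, hFc⟩ := hmain
  have hSne : S'.Nonempty := by
    rw [← Finset.card_pos]; omega
  obtain ⟨x, c, hc, hcF⟩ := euler a b hab F (hSne.mono hSF) hF hFc
  refine ⟨x, c, hc, fun e he => ?_⟩
  exact hcF ⟨e, hSE he⟩ (hSF (by simpa [S'] using he))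

end graph

end CircP

/-- If a connected graph contains a circuit through any `2k-1` prescribed edges,
then it also contains a circuit through any `2k` prescribed edges. -/
theorem stmt1 {V : Type*} [Fintype V] (G : SimpleGraph V) (hG : G.Connected) (k : ℕ)
    (h : ∀ S : Set (Sym2 V), S ⊆ G.edgeSet → S.ncard = 2 * k - 1 → CircuitThrough G S) :
    ∀ S : Set (Sym2 V), S ⊆ G.edgeSet → S.ncard = 2 * k → CircuitThrough G S := by
  intro S hSE hS
  rcases Nat.eq_zero_or_pos k with hk | hk
  · subst hk
    exact h S hSE (by simpa using hS)
  · exact CircP.final hG k hk h S hSE hS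
end

section
/- Let k ≥ 3, let G be the ladder graph P_{k+1} × K_2 (with k+1 rungs), and let S be a set of rungs with 3 ≤ |S| ≤ k. Then S is contained in the edge set of an even subgraph of G, but every even subgraph of G containing S has at least ⌈|S|/2⌉ connected components with at least one edge. -/
open SimpleGraph

/-- The ladder graph with `k+1` rungs: the Cartesian (box) product of the path
on `k+1` vertices with `K_2`. -/
def ladder (k : ℕ) : SimpleGraph (Fin (k + 1) × Fin 2) :=
  SimpleGraph.boxProd (SimpleGraph.pathGraph (k + 1)) (completeGraph (Fin 2))

/-- The `i`-th rung of the ladder. -/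
def rung {k : ℕ} (i : Fin (k + 1)) : Sym2 (Fin (k + 1) × Fin 2) :=
  s((i, (0 : Fin 2)), (i, (1 : Fin 2)))


lemma ncard_subsing {α : Type*} (s : Set α) (P : Prop) [Decidable P]
    (h : s.Subsingleton) (hP : s.Nonempty ↔ P) : s.ncard = if P then 1 else 0 := by
  rcases h.eq_empty_or_singleton with h | ⟨x, rfl⟩
  · subst h
    have : ¬ P := by rw [← hP]; simp
    simp [this]
  · have : P := by rw [← hP]; simp
    simp [this]

def Rr {k : ℕ} (H : SimpleGraph (Fin (k + 1) × Fin 2)) (i : ℕ) : Prop :=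
  ∃ h : i < k + 1, H.Adj (⟨i, h⟩, 0) (⟨i, h⟩, 1)

def Xx {k : ℕ} (H : SimpleGraph (Fin (k + 1) × Fin 2)) (a : Fin 2) (i : ℕ) : Prop :=
  ∃ h : i + 1 < k + 1, H.Adj (⟨i, by omega⟩, a) (⟨i + 1, h⟩, a)

lemma ladder_adj {k : ℕ} (v w : Fin (k + 1) × Fin 2) : (ladder k).Adj v w ↔
    (v.1 = w.1 ∧ v.2 ≠ w.2) ∨
      (v.2 = w.2 ∧ (v.1.val + 1 = w.1.val ∨ w.1.val + 1 = v.1.val)) := by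
  unfold ladder
  rw [SimpleGraph.boxProd_adj, SimpleGraph.pathGraph_adj]
  simp only [completeGraph, SimpleGraph.top_adj]
  tauto

open Classical in
lemma deg_eq {k : ℕ} (H : SimpleGraph (Fin (k + 1) × Fin 2)) (hH : H ≤ ladder k)
    (i : ℕ) (h : i < k + 1) (a : Fin 2) :
    (H.neighborSet (⟨i, h⟩, a)).ncard = (if Rr H i then 1 else 0) + (if Xx H a i then 1 else 0)
      + (if 0 < i ∧ Xx H a (i - 1) then 1 else 0) := by
  let N := H.neighborSet (⟨i, h⟩, a)
  let A := {w ∈ N | w.1.val = i}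
  let B := {w ∈ N | w.1.val = i + 1}
  let C := {w ∈ N | w.1.val + 1 = i}
  have hN : N = (A ∪ B) ∪ C := by
    ext w
    simp only [A, B, C, Set.mem_union, Set.mem_ofPred_eq]
    constructor
    · intro hw
      have := (ladder_adj _ _).1 (hH hw)
      simp only [Fin.ext_iff] at this
      rcases this with h1 | h1
      · exact Or.inl (Or.inl ⟨hw, h1.1.symm⟩)
      · rcases h1.2 with h2 | h2
        · exact Or.inl (Or.inr ⟨hw, h2.symm⟩)
        · exact Or.inr ⟨hw, h2⟩
    · tauto
  have key : ∀ w ∈ N, (w.1.val = i ∧ a ≠ w.2) ∨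
      (a = w.2 ∧ (i + 1 = w.1.val ∨ w.1.val + 1 = i)) := by
    intro w hw
    have := (ladder_adj _ _).1 (hH hw)
    rcases this with h1 | h1
    · exact Or.inl ⟨(congrArg Fin.val h1.1).symm, h1.2⟩
    · exact Or.inr h1
  have hA : A.ncard = if Rr H i then 1 else 0 := by
    apply ncard_subsing
    · rintro ⟨w1, w2⟩ ⟨hw, hwi⟩ ⟨u1, u2⟩ ⟨hu, hui⟩
      have := key _ hw
      have := key _ hu
      simp only [Prod.mk.injEq, Fin.ext_iff] at *
      grind
    · constructor
      · rintro ⟨⟨w1, w2⟩, hw, hwi⟩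
        have h2 := key _ hw
        simp only at hwi h2
        subst hwi
        have hw' : H.Adj (w1, a) (w1, w2) := hw
        refine ⟨h, ?_⟩
        have : a ≠ w2 := by
          rcases h2 with h2 | h2
          · exact h2.2
          · omega
        fin_cases a <;> fin_cases w2
        · exact absurd rfl this
        · exact hw'
        · exact hw'.symm
        · exact absurd rfl this
      · rintro ⟨_, hadj⟩
        fin_cases a
        · exact ⟨(⟨i, h⟩, 1), hadj, rfl⟩
        · exact ⟨(⟨i, h⟩, 0), hadj.symm, rfl⟩
  have hB : B.ncard = if Xx H a i then 1 else 0 := by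
    apply ncard_subsing
    · rintro ⟨w1, w2⟩ ⟨hw, hwi⟩ ⟨u1, u2⟩ ⟨hu, hui⟩
      have := key _ hw
      have := key _ hu
      simp only [Prod.mk.injEq, Fin.ext_iff] at *
      grind
    · constructor
      · rintro ⟨⟨⟨w1, hw1⟩, w2⟩, hw, hwi⟩
        have h2 := key _ hw
        simp only at hwi h2
        subst hwi
        have : a = w2 := by
          rcases h2 with h2 | h2
          · omega
          · exact h2.1
        subst this
        exact ⟨hw1, hw⟩
      · rintro ⟨h1, hadj⟩
        exact ⟨(⟨i + 1, h1⟩, a), hadj, rfl⟩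
  have hC : C.ncard = if 0 < i ∧ Xx H a (i - 1) then 1 else 0 := by
    apply ncard_subsing
    · rintro ⟨w1, w2⟩ ⟨hw, hwi⟩ ⟨u1, u2⟩ ⟨hu, hui⟩
      have := key _ hw
      have := key _ hu
      simp only [Prod.mk.injEq, Fin.ext_iff] at *
      grind
    · constructor
      · rintro ⟨⟨⟨w1, hw1⟩, w2⟩, hw, hwi⟩
        have h2 := key _ hw
        simp only at hwi h2
        subst hwi
        have : a = w2 := by
          rcases h2 with h2 | h2
          · omega
          · exact h2.1
        subst this
        exact ⟨by omega, h, SimpleGraph.Adj.symm hw⟩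
      · rintro ⟨h0, h1, hadj⟩
        obtain ⟨j, rfl⟩ : ∃ j, i = j + 1 := ⟨i - 1, by omega⟩
        exact ⟨(⟨j, by omega⟩, a), hadj.symm, rfl⟩
  change N.ncard = _
  rw [hN, Set.ncard_union_eq, Set.ncard_union_eq, hA, hB, hC]
  · rw [Set.disjoint_left]
    rintro w ⟨_, h1⟩ ⟨_, h2⟩
    omega
  · rw [Set.disjoint_left]
    rintro w (⟨_, h1⟩ | ⟨_, h1⟩) ⟨_, h2⟩ <;> omega

/-- number of elements of `T` below `i` -/
def qq {n : ℕ} (T : Finset (Fin n)) (i : ℕ) : ℕ := (T.filter (fun t => t.val < i)).card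

lemma qq_zero {n : ℕ} (T : Finset (Fin n)) : qq T 0 = 0 := by simp [qq]

open Classical in
lemma qq_succ {n : ℕ} (T : Finset (Fin n)) (i : ℕ) :
    qq T (i + 1) = qq T i + if (∃ h : i < n, (⟨i, h⟩ : Fin n) ∈ T) then 1 else 0 := by
  unfold qq
  split_ifs with h
  · obtain ⟨h, hT⟩ := h
    rw [← Finset.card_insert_of_notMem (a := (⟨i, h⟩ : Fin n)) (by simp)]
    congr 1
    ext t
    simp only [Finset.mem_filter, Finset.mem_insert, Fin.ext_iff]
    constructor
    · rintro ⟨h1, h2⟩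
      by_cases h3 : t.val = i
      · exact Or.inl h3
      · exact Or.inr ⟨h1, by omega⟩
    · rintro (h1 | ⟨h1, h2⟩)
      · refine ⟨?_, by omega⟩
        have : t = ⟨i, h⟩ := Fin.ext h1
        rwa [this]
      · exact ⟨h1, by omega⟩
  · rw [add_zero]
    congr 1
    ext t
    simp only [Finset.mem_filter]
    constructor
    · rintro ⟨h1, h2⟩
      refine ⟨h1, ?_⟩
      by_contra h3
      have h4 : t.val = i := by omega
      subst h4
      exact h ⟨t.2, h1⟩
    · rintro ⟨h1, h2⟩
      exact ⟨h1, by omega⟩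

lemma qq_mono {n : ℕ} (T : Finset (Fin n)) : Monotone (qq T) := by
  classical
  apply monotone_nat_of_le_succ
  intro i
  rw [qq_succ]
  omega

lemma qq_lt {n : ℕ} (T : Finset (Fin n)) {i j : Fin n} (hi : i ∈ T) (hij : i < j) :
    qq T i < qq T j := by
  classical
  have h1 : qq T (i.val + 1) ≤ qq T j := qq_mono T hij
  rw [qq_succ, if_pos ⟨i.2, hi⟩] at h1
  omega

lemma qq_top {n : ℕ} (T : Finset (Fin n)) : qq T n = T.card := by
  unfold qq
  rw [Finset.filter_true_of_mem]
  intro t _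
  exact t.2

lemma rung_inj {k : ℕ} : Function.Injective (rung (k := k)) := by
  intro i j h
  simpa [rung] using h

/-- the even subgraph with prescribed rungs -/
def evenG {k : ℕ} (T : Finset (Fin (k + 1))) : SimpleGraph (Fin (k + 1) × Fin 2) where
  Adj v w := (v.1 = w.1 ∧ v.2 ≠ w.2 ∧ v.1 ∈ T) ∨
    (v.2 = w.2 ∧ ((v.1.val + 1 = w.1.val ∧ Odd (qq T w.1.val)) ∨
      (w.1.val + 1 = v.1.val ∧ Odd (qq T v.1.val))))
  symm := ⟨by
    rintro v w (⟨h1, h2, h3⟩ | ⟨h1, h2⟩)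
    · exact Or.inl ⟨h1.symm, h2.symm, h1 ▸ h3⟩
    · exact Or.inr ⟨h1.symm, h2.symm⟩⟩
  loopless := ⟨by
    rintro v (⟨h1, h2, h3⟩ | ⟨h1, h2 | h2⟩)
    · exact h2 rfl
    · omega
    · omega⟩

lemma evenG_even {k : ℕ} (T : Finset (Fin (k + 1))) (hT : Even T.card) :
    evenG T ≤ ladder k ∧ (∀ v, Even (((evenG T).neighborSet v).ncard)) ∧
      ∀ i ∈ T, rung i ∈ (evenG T).edgeSet := by
  classical
  have hle : evenG T ≤ ladder k := by
    intro v w h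
    rw [ladder_adj]
    simp only [evenG] at h
    tauto
  refine ⟨hle, ?_, ?_⟩
  · rintro ⟨⟨i, h⟩, a⟩
    rw [deg_eq _ hle]
    have hR : Rr (evenG T) i ↔ ∃ h : i < k + 1, (⟨i, h⟩ : Fin (k + 1)) ∈ T := by
      simp [Rr, evenG]
    have hX : ∀ j, Xx (evenG T) a j ↔ j + 1 < k + 1 ∧ Odd (qq T (j + 1)) := by
      intro j
      unfold Xx evenG
      constructor
      · rintro ⟨h, ⟨_, h2, _⟩ | ⟨_, ⟨_, h2⟩ | ⟨h2, _⟩⟩⟩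
        · exact absurd rfl h2
        · exact ⟨h, h2⟩
        · simp only at h2
          omega
      · rintro ⟨h, h2⟩
        exact ⟨h, Or.inr ⟨rfl, Or.inl ⟨rfl, h2⟩⟩⟩
    have htop := qq_top T
    have hs := qq_succ T i
    have h0 := qq_zero T
    rw [hX, hX, hR]
    have hXi : (i + 1 < k + 1 ∧ Odd (qq T (i + 1))) ↔ Odd (qq T (i + 1)) := by
      constructor
      · exact fun h => h.2
      · intro h'
        refine ⟨?_, h'⟩
        by_contra hc
        have : i + 1 = k + 1 := by omega
        rw [this, htop] at h'
        exact (Nat.not_odd_iff_even.2 hT) h'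
    have hXp : (0 < i ∧ i - 1 + 1 < k + 1 ∧ Odd (qq T (i - 1 + 1))) ↔ Odd (qq T i) := by
      rcases Nat.eq_zero_or_pos i with rfl | hp
      · simp [h0]
      · rw [Nat.sub_add_cancel hp]
        simp [hp, h]
    simp only [hXi, hXp]
    simp only [Nat.odd_iff, Nat.even_iff] at *
    split_ifs at * <;> omega
  · intro i hi
    simp [rung, evenG, hi]

/-- A set `S` of at least 3 and at most `k` rungs of the ladder with `k+1` rungs extends to
an even subgraph, but every even subgraph containing `S` has at least `⌈|S|/2⌉`
connected components containing an edge. -/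
theorem stmt3 (k : ℕ) (hk : 3 ≤ k) (S : Set (Sym2 (Fin (k + 1) × Fin 2)))
    (hrungs : ∀ e ∈ S, ∃ i : Fin (k + 1), e = rung i)
    (h3 : 3 ≤ S.ncard) (hSk : S.ncard ≤ k) :
    (∃ H : SimpleGraph (Fin (k + 1) × Fin 2), H ≤ ladder k ∧
        (∀ v, Even ((H.neighborSet v).ncard)) ∧ S ⊆ H.edgeSet) ∧
      (∀ H : SimpleGraph (Fin (k + 1) × Fin 2), H ≤ ladder k →
        (∀ v, Even ((H.neighborSet v).ncard)) → S ⊆ H.edgeSet →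
        (S.ncard + 1) / 2 ≤
          {C : H.ConnectedComponent |
            ∃ v, (H.neighborSet v).Nonempty ∧ H.connectedComponentMk v = C}.ncard) := by
  classical
  let T : Finset (Fin (k + 1)) := Finset.univ.filter (fun i => rung i ∈ S)
  have hST : S = rung '' (T : Set (Fin (k + 1))) := by
    ext e
    simp only [T, Finset.coe_filter, Finset.mem_univ, true_and, Set.mem_image, Set.mem_ofPred_eq]
    constructor
    · intro he
      obtain ⟨i, rfl⟩ := hrungs e he
      exact ⟨i, he, rfl⟩
    · rintro ⟨i, hi, rfl⟩
      exact hi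
  have hcard : S.ncard = T.card := by
    rw [hST, Set.ncard_image_of_injective _ rung_inj, Set.ncard_coe_finset]
  constructor
  · obtain ⟨T', hsub, hev⟩ : ∃ T' : Finset (Fin (k + 1)), T ⊆ T' ∧ Even T'.card := by
      by_cases he : Even T.card
      · exact ⟨T, Finset.Subset.refl _, he⟩
      · have : ∃ x, x ∉ T := by
          by_contra! hc
          have : T = Finset.univ := Finset.eq_univ_of_forall hc
          rw [this] at hcard
          simp at hcard
          omega
        obtain ⟨x, hx⟩ := this
        refine ⟨insert x T, Finset.subset_insert _ _, ?_⟩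
        rw [Finset.card_insert_of_notMem hx]
        exact (Nat.not_even_iff_odd.1 he).add_one
    obtain ⟨h1, h2, h4⟩ := evenG_even T' hev
    refine ⟨evenG T', h1, h2, ?_⟩
    rw [hST]
    rintro _ ⟨i, hi, rfl⟩
    exact h4 i (hsub hi)
  · intro H hle hev hSH
    let U : Finset (Fin (k + 1)) := Finset.univ.filter (fun i => H.Adj (i, 0) (i, 1))
    have hTU : T ⊆ U := by
      intro i hi
      have : rung i ∈ S := by simpa [T] using hi
      have := hSH this
      simpa [U, rung] using this
    have hR : ∀ i, Rr H i ↔ ∃ h : i < k + 1, (⟨i, h⟩ : Fin (k + 1)) ∈ U := by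
      intro i
      simp [Rr, U]
    have hX : ∀ a i, i < k + 1 → (Xx H a i ↔ Odd (qq U (i + 1))) := by
      intro a i
      induction i with
      | zero =>
        intro h
        have := hev (⟨0, h⟩, a)
        rw [deg_eq _ hle] at this
        rw [qq_succ, qq_zero]
        simp only [← hR]
        simp only [Nat.odd_iff, Nat.even_iff] at *
        split_ifs at * <;> simp_all
      | succ i ih =>
        intro h
        have := hev (⟨i + 1, h⟩, a)
        rw [deg_eq _ hle] at this
        have ih := ih (by omega)
        rw [qq_succ]
        simp only [← hR]
        simp only [Nat.add_sub_cancel, Nat.succ_pos, true_and, ih] at this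
        simp only [Nat.odd_iff, Nat.even_iff] at *
        by_cases hx : Xx H a (i + 1) <;> simp only [hx, if_true, if_false, true_iff, false_iff] at * <;>
          split_ifs at * <;> omega
    let lab : Fin (k + 1) × Fin 2 → ℕ := fun v => qq U v.1.val / 2
    have hstep : ∀ (i : ℕ) (h : i + 1 < k + 1) (a : Fin 2),
        H.Adj (⟨i, by omega⟩, a) (⟨i + 1, h⟩, a) → qq U i / 2 = qq U (i + 1) / 2 := by
      intro i h a hadj
      have h1 := (hX a i (by omega)).1 ⟨h, hadj⟩
      have h2 := qq_succ U i
      rw [Nat.odd_iff] at h1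
      split_ifs at h2 <;> omega
    have hlab : ∀ v w, H.Adj v w → lab v = lab w := by
      rintro ⟨⟨i, hi⟩, a⟩ ⟨⟨j, hj⟩, b⟩ hadj
      have h1 := (ladder_adj _ _).1 (hle hadj)
      simp only [Fin.mk.injEq] at h1
      simp only [lab]
      rcases h1 with ⟨h1, _⟩ | ⟨h1, h2 | h2⟩
      · rw [h1]
      · subst h1 h2
        exact hstep i hj a hadj
      · subst h1 h2
        exact (hstep j hi a hadj.symm).symm
    have hreach : ∀ v w, H.Reachable v w → lab v = lab w := by
      rintro v w ⟨p⟩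
      induction p with
      | nil => rfl
      | cons h _ ih => exact (hlab _ _ h).trans ih
    let L : H.ConnectedComponent → ℕ := fun C => C.lift lab (fun v w p _ => hreach v w ⟨p⟩)
    set CC := {C : H.ConnectedComponent |
            ∃ v, (H.neighborSet v).Nonempty ∧ H.connectedComponentMk v = C} with hCC
    let f : Fin (k + 1) → ℕ := fun i => qq U i.val / 2
    have hsub : ((T.image f : Finset ℕ) : Set ℕ) ⊆ L '' CC := by
      intro n hn
      simp only [Finset.coe_image, Set.mem_image] at hn
      obtain ⟨i, hi, rfl⟩ := hn
      have hiU := hTU hi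
      simp only [U, Finset.mem_filter] at hiU
      exact ⟨H.connectedComponentMk (i, 0), ⟨(i, 0), ⟨(i, 1), hiU.2⟩, rfl⟩, rfl⟩
    have hle1 : (T.image f).card ≤ CC.ncard := by
      rw [← Set.ncard_coe_finset]
      exact (Set.ncard_le_ncard hsub (Set.toFinite _)).trans (Set.ncard_image_le (Set.toFinite _))
    have hle2 : T.card ≤ 2 * (T.image f).card := by
      apply Finset.card_le_mul_card_image
      intro n hn
      have hinj : Set.InjOn (fun i : Fin (k + 1) => qq U i.val)
          ((T.filter (fun i => f i = n) : Finset (Fin (k + 1))) : Set (Fin (k + 1))) := by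
        intro i hi j hj hij
        simp only [Finset.coe_filter, Set.mem_ofPred_eq] at hi hj
        simp only at hij
        rcases lt_trichotomy i j with h | h | h
        · have := qq_lt U (hTU hi.1) h
          omega
        · exact h
        · have := qq_lt U (hTU hj.1) h
          omega
      rw [← Finset.card_image_of_injOn hinj]
      have : Finset.image (fun i : Fin (k + 1) => qq U i.val) (T.filter (fun i => f i = n)) ⊆
          {2 * n, 2 * n + 1} := by
        intro m hm
        simp only [Finset.mem_image, Finset.mem_filter, f] at hm
        obtain ⟨i, ⟨_, h1⟩, h2⟩ := hm
        simp only [Finset.mem_insert, Finset.mem_singleton]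
        omega
      exact (Finset.card_le_card this).trans Finset.card_le_two
    omega
end

section
/- Let G be a finite simple graph containing no odd edge cut of size at most k+1, let e_1,…,e_{k+1} be k+1 edges of G, and let H be a circuit of G through e_1,…,e_k such that e_{k+1} is a bridge of G − E(H). Then G contains a circuit through e_1,…,e_{k+1}; moreover, if an endpoint of e_{k+1} does not lie on H, the circuit can be chosen to pass through that endpoint exactly once. -/
open SimpleGraph

/-- The edge boundary (cut) `∂A` of a vertex set `A` in a graph `G`. -/
def edgeCut {V : Type*} (G : SimpleGraph V) (A : Set V) : Set (Sym2 V) :=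
  {e | ∃ u v, G.Adj u v ∧ u ∈ A ∧ v ∉ A ∧ e = s(u, v)}

/-- `G` has an odd cut of size at most `k`. -/
def HasOddCutLE {V : Type*} (G : SimpleGraph V) (k : ℕ) : Prop :=
  ∃ A : Set V, Odd (edgeCut G A).ncard ∧ (edgeCut G A).ncard ≤ k


section hop
variable {V : Type*} {G : SimpleGraph V}

/-- Reversal of a list of darts. -/
def revD (L : List G.Dart) : List G.Dart := (L.map Dart.symm).reverse

lemma revD_revD (L : List G.Dart) : revD (revD L) = L := by
  simp [revD, List.map_reverse]

lemma revD_contig {L L' : List G.Dart} (h : L <:+: L') : revD L <:+: revD L' := by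
  unfold revD
  exact List.reverse_infix.2 (h.map _)

lemma mem_revD {L : List G.Dart} {d : G.Dart} : d ∈ revD L ↔ d.symm ∈ L := by
  simp only [revD, List.mem_reverse, List.mem_map]
  constructor
  · rintro ⟨d', h, rfl⟩; simpa using h
  · intro h; exact ⟨_, h, by simp⟩

/-- an infix avoiding a nonempty middle block lies in one of the sides -/
lemma contig_sides {α : Type*} {W A B C : List α} (h : W <:+: A ++ B ++ C) (hB : B ≠ [])
    (hd : ∀ d ∈ W, d ∉ B) : W <:+: A ∨ W <:+: C := by
  obtain ⟨P, S, h⟩ := h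
  rw [List.append_assoc, List.append_assoc, List.append_eq_append_iff] at h
  rcases h with ⟨A', rfl, h⟩ | ⟨C', rfl, h⟩
  · skip
    rw [List.append_eq_append_iff] at h
    rcases h with ⟨D, rfl, h⟩ | ⟨D, rfl, h⟩
    · left; exact ⟨P, D, by simp⟩
    · skip
      cases D with
      | nil => left; exact ⟨P, [], by simp⟩
      | cons d D =>
        cases B with
        | nil => exact absurd rfl hB
        | cons b B =>
          simp only [List.cons_append, List.cons.injEq] at h
          exact absurd (by simp [h.1]) (hd d (by simp))
  · skip
    rw [List.append_eq_append_iff] at h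
    rcases h with ⟨D, rfl, h⟩ | ⟨D, rfl, h⟩
    · right; exact ⟨D, S, by simp [h]⟩
    · cases W with
      | nil => right; exact List.nil_infix
      | cons w W =>
        cases D with
        | nil => right; exact ⟨[], S, by simpa using h⟩
        | cons d D =>
          simp only [List.cons_append, List.cons.injEq] at h
          exact absurd (by simp [h.1]) (hd w (by simp))

variable {x : V}

/-- darts of `H` at indices in `[s,t)` -/
def dS {y : V} (H : G.Walk x y) (s t : ℕ) : List G.Dart := (H.darts.drop s).take (t - s)

/-- the piece of `H` between positions `s` and `t` -/
def sl {y : V} (H : G.Walk x y) (s t : ℕ) (h : s ≤ t) : G.Walk (H.getVert s) (H.getVert t) :=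
  ((H.drop s).take (t - s)).copy rfl (by rw [Walk.drop_getVert]; congr 1; omega)

lemma sl_darts {y : V} (H : G.Walk x y) (s t : ℕ) (h : s ≤ t) : (sl H s t h).darts = dS H s t := by
  simp [sl, dS, Walk.darts_take, Walk.darts_drop]

lemma dS_contig {y : V} (H : G.Walk x y) {s u u' t : ℕ} (h1 : s ≤ u) (h2 : u ≤ u') (h3 : u' ≤ t) :
    dS H u u' <:+: dS H s t := by
  have e1 : dS H u u' = ((dS H s t).drop (u - s)).take (u' - u) := by
    unfold dS
    rw [List.drop_take, List.drop_drop, List.take_take]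
    congr 1
    · omega
    · congr 1; omega
  rw [e1]
  exact (List.take_prefix _ _).isInfix.trans (List.drop_suffix _ _).isInfix

lemma mem_dS {y : V} (H : G.Walk x y) {s t : ℕ} {d : G.Dart} (h : d ∈ dS H s t) :
    ∃ i, ∃ hi : i < H.darts.length, s ≤ i ∧ i < t ∧ d = H.darts[i] := by
  unfold dS at h
  rw [List.mem_take_iff_getElem] at h
  obtain ⟨j, hj, rfl⟩ := h
  simp only [List.length_drop] at hj
  refine ⟨s + j, by omega, by omega, by omega, ?_⟩
  simp [List.getElem_drop]

lemma dS_disj {y : V} (H : G.Walk x y) (hH : H.IsTrail) {s t s' t' : ℕ} (h : t ≤ s' ∨ t' ≤ s)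
    {d d' : G.Dart} (hd : d ∈ dS H s t) (hd' : d' ∈ dS H s' t') : d.edge ≠ d'.edge := by
  obtain ⟨i, hi, h1, h2, rfl⟩ := mem_dS H hd
  obtain ⟨j, hj, h3, h4, rfl⟩ := mem_dS H hd'
  intro e
  have hn := hH.edges_nodup
  unfold Walk.edges at hn
  have := (List.Nodup.getElem_inj_iff hn (i := i) (hi := by simpa using hi)
    (j := j) (hj := by simpa using hj)).1 (by simpa using e)
  omega

/-- the piece `[s,t]` of `H` is traversed contiguously by `T` -/
def Has {y : V} (H : G.Walk x y) {p q : V} (T : G.Walk q p) (s t : ℕ) : Prop :=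
  dS H s t <:+: T.darts ∨ revD (dS H s t) <:+: T.darts

lemma darts_reverse_revD {p q : V} (T : G.Walk q p) : T.reverse.darts = revD T.darts := by
  simp [revD, Walk.darts_reverse]

lemma Has.reverse {y : V} {H : G.Walk x y} {p q : V} {T : G.Walk q p} {s t : ℕ} (h : Has H T s t) :
    Has H T.reverse s t := by
  unfold Has at *
  rw [darts_reverse_revD]
  rcases h with h | h
  · exact Or.inr (revD_contig h)
  · left; have := revD_contig h; rwa [revD_revD] at this

lemma Has.swap {y : V} (H : G.Walk x y) (hH : H.IsTrail) {q u u2 p : V} (T1 : G.Walk q u)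
    (R : G.Walk u u2) (T2 : G.Walk u2 p) (Q : G.Walk u p) {lo hi s t : ℕ}
    (hR : ∀ d ∈ R.darts, ∃ d' ∈ dS H lo hi, d'.edge = d.edge) (hRn : R.darts ≠ [])
    (hst : t ≤ lo ∨ hi ≤ s) (h : Has H ((T1.append R).append T2) s t) :
    Has H ((T1.append Q).append T2.reverse) s t := by
  have key : ∀ L : List G.Dart, (∀ d ∈ L, ∃ d' ∈ dS H s t, d'.edge = d.edge) →
      L <:+: ((T1.append R).append T2).darts →
      L <:+: ((T1.append Q).append T2.reverse).darts ∨
      revD L <:+: ((T1.append Q).append T2.reverse).darts := by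
    intro L hL hi'
    rw [Walk.darts_append, Walk.darts_append] at hi'
    rcases contig_sides hi' hRn (by
      intro d hd hd2
      obtain ⟨d1, h1, e1⟩ := hL d hd
      obtain ⟨d2, h2, e2⟩ := hR d hd2
      exact dS_disj H hH hst h1 h2 (e1.trans e2.symm)) with h | h
    · left
      rw [Walk.darts_append, Walk.darts_append, List.append_assoc]
      exact h.trans (List.prefix_append _ _).isInfix
    · right
      rw [Walk.darts_append, darts_reverse_revD]
      exact (revD_contig h).trans (List.suffix_append _ _).isInfix
  rcases h with h | h
  · exact key _ (fun d hd => ⟨d, hd, rfl⟩) h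
  · have := key _ (fun d hd => ⟨d.symm, mem_revD.1 hd, by simp⟩) h
    rw [revD_revD] at this
    exact this.symm


/-- Properties of the increasing chain of vertex sets. -/
structure Lev (N : SimpleGraph V) (H : G.Walk x x) (seg : ℕ → ℕ) (X : ℕ → Set V) : Prop where
  mono : ∀ l, X l ⊆ X (l + 1)
  closed : ∀ l v w, v ∈ X l → N.Reachable v w → w ∈ X l
  up : ∀ l s u t p, s ≤ u → u ≤ t → t ≤ H.length → seg s = seg t → H.getVert s ∈ X l →
    H.getVert t ∈ X l → N.Reachable (H.getVert u) p → p ∈ X (l + 1)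
  down : ∀ l p, p ∈ X (l + 1) → p ∈ X l ∨ ∃ s u t, s ≤ u ∧ u ≤ t ∧ t ≤ H.length ∧ seg s = seg t ∧
    H.getVert s ∈ X l ∧ H.getVert t ∈ X l ∧ N.Reachable (H.getVert u) p

lemma Lev.mono' {N : SimpleGraph V} {H : G.Walk x x} {seg : ℕ → ℕ} {X : ℕ → Set V}
    (hX : Lev N H seg X) {l m : ℕ} (h : l ≤ m) : X l ⊆ X m :=
  monotone_nat_of_le_succ (f := X) hX.mono h

/-- The invariant of the hopping argument. -/
structure HopInv (N : SimpleGraph V) (H : G.Walk x x) (seg : ℕ → ℕ) (M : Set (Sym2 V))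
    (X Y : ℕ → Set V) (i j : ℕ) {q p : V} (T : G.Walk q p) : Prop where
  trail : T.IsTrail
  marks : ∀ m ∈ M, m ∈ T.edges
  hp : p ∈ X i
  hq : q ∈ Y j
  hasX : ∀ l < i, ∀ s t, s < t → t ≤ H.length → seg s = seg t → H.getVert s ∈ X l →
    H.getVert t ∈ X l → Has H T s t
  hasY : ∀ l < j, ∀ s t, s < t → t ≤ H.length → seg s = seg t → H.getVert s ∈ Y l →
    H.getVert t ∈ Y l → Has H T s t
  avoid : ∀ v w, N.Adj v w → v ∈ X i ∪ Y j → s(v, w) ∉ T.edges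
  vert : ∀ v ∈ T.support, v ∈ X 0 ∪ Y 0 → v ∈ H.support
  sub : ∀ f ∈ T.edges, f ∈ H.edges ∨ f ∈ N.edgeSet

lemma HopInv.symm {N : SimpleGraph V} {H : G.Walk x x} {seg : ℕ → ℕ} {M : Set (Sym2 V)}
    {X Y : ℕ → Set V} {i j : ℕ} {q p : V} {T : G.Walk q p} (h : HopInv N H seg M X Y i j T) :
    HopInv N H seg M Y X j i T.reverse where
  trail := h.trail.reverse
  marks := by simpa using h.marks
  hp := h.hq
  hq := h.hp
  hasX := fun l hl s t h1 h2 h3 h4 h5 => (h.hasY l hl s t h1 h2 h3 h4 h5).reverse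
  hasY := fun l hl s t h1 h2 h3 h4 h5 => (h.hasX l hl s t h1 h2 h3 h4 h5).reverse
  avoid := fun v w h1 h2 => by simpa using h.avoid v w h1 h2.symm
  vert := fun v h1 h2 => h.vert v (by simpa using h1) h2.symm
  sub := by simpa using h.sub

lemma hop_core {N : SimpleGraph V} (hNG : N ≤ G) {H : G.Walk x x} (hH : H.IsTrail) {seg : ℕ → ℕ}
    (hseg : Monotone seg) {M : Set (Sym2 V)}
    (hM : ∀ s t, s ≤ t → seg s = seg t → ∀ d ∈ dS H s t, d.edge ∉ M)
    {X Y : ℕ → Set V} (hX : Lev N H seg X) (hY : Lev N H seg Y) {i j : ℕ}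
    (nc : ∀ i' j', i' + j' < i + 1 + j → ∀ s t, s ≤ H.length → t ≤ H.length →
      H.getVert s ∈ X i' → H.getVert t ∈ Y j' → seg s ≠ seg t)
    {q p : V} {pu lo hi z : ℕ} {u2 : V} (T1 : G.Walk q (H.getVert pu)) (R : G.Walk (H.getVert pu) u2)
    (T2 : G.Walk u2 p)
    (hT : HopInv N H seg M X Y (i + 1) j ((T1.append R).append T2)) (hpX : p ∉ X i)
    (hpu : N.Reachable (H.getVert pu) p) (hu2 : u2 ∈ X i) (hhi : hi ≤ H.length)
    (hlohi : lo < hi) (hsl : seg lo = seg hi) (hpu1 : lo ≤ pu) (hpu2 : pu ≤ hi)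
    (hz : lo ≤ z ∧ z ≤ hi ∧ H.getVert z ∈ X i)
    (hR : ∀ d ∈ R.darts, ∃ d' ∈ dS H lo hi, d'.edge = d.edge) (hRn : R.darts ≠ [])
    (hgap : ∀ s t, s < t → s < hi → lo < t → H.getVert s ∈ X i → H.getVert t ∈ X i →
      s ≤ pu ∧ pu ≤ t) :
    ∃ T' : G.Walk q u2, HopInv N H seg M X Y i j T' := by
  classical
  obtain ⟨w, hw⟩ := hpu.exists_isPath
  have segeq : ∀ r, lo ≤ r → r ≤ hi → seg r = seg lo := by
    intro r h1 h2
    have := hseg h1; have := hseg h2; omega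
  have hQv : ∀ v, v ∈ w.support → v ∉ X i ∪ Y j := by
    intro v hv hvX
    have hvp : N.Reachable v p := ⟨(w.dropUntil v hv)⟩
    have hvu : N.Reachable v (H.getVert pu) := ⟨(w.takeUntil v hv).reverse⟩
    rcases hvX with hvX | hvY
    · exact hpX (hX.closed _ _ _ hvX hvp)
    · exact nc i j (by omega) z pu (by omega) (by omega) hz.2.2 (hY.closed _ _ _ hvY hvu)
        ((segeq z hz.1 hz.2.1).trans (segeq pu hpu1 hpu2).symm)
  have hpi : ∀ v, v ∈ w.support → v ∈ X (i + 1) := by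
    intro v hv
    exact hX.closed _ _ _ hT.hp ⟨(w.dropUntil v hv).reverse⟩
  have htr := hT.trail.edges_nodup
  have hQN : ∀ f ∈ w.edges, f ∈ N.edgeSet := fun f hf => w.edges_subset_edgeSet hf
  have hQT : ∀ f ∈ w.edges, f ∉ ((T1.append R).append T2).edges := by
    intro f hf
    induction f with
    | h v v' =>
    exact hT.avoid v v' (hQN _ hf) (Or.inl (hpi v (w.fst_mem_support_of_mem_edges hf)))
  refine ⟨(T1.append (w.mapLe hNG)).append T2.reverse, ?_⟩
  have hE : ∀ f, f ∈ ((T1.append (w.mapLe hNG)).append T2.reverse).edges →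
      f ∈ ((T1.append R).append T2).edges ∨ f ∈ w.edges := by
    intro f hf
    simp only [Walk.edges_append, List.mem_append, Walk.edges_mapLe_eq_edges, Walk.edges_reverse,
      List.mem_reverse] at hf ⊢
    tauto
  constructor
  · rw [Walk.isTrail_def]
    simp only [Walk.edges_append, Walk.edges_mapLe_eq_edges, Walk.edges_reverse] at htr hQT ⊢
    have hwn := hw.isTrail.edges_nodup
    simp only [List.nodup_append, List.mem_append, List.nodup_reverse, List.mem_reverse] at *
    grind
  · intro m hm
    have h1 := hT.marks m hm
    simp only [Walk.edges_append, List.mem_append, Walk.edges_mapLe_eq_edges, Walk.edges_reverse,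
      List.mem_reverse] at h1 ⊢
    rcases h1 with (h1 | h1) | h1
    · tauto
    · exfalso
      unfold Walk.edges at h1
      obtain ⟨d, hd, rfl⟩ := List.mem_map.1 h1
      obtain ⟨d', hd', e⟩ := hR d hd
      exact hM lo hi hlohi.le hsl d' hd' (e ▸ hm)
    · tauto
  · exact hu2
  · exact hT.hq
  · intro l hl s t h1 h2 h3 h4 h5
    refine Has.swap H hH T1 R T2 _ hR hRn ?_ (hT.hasX l (by omega) s t h1 h2 h3 h4 h5)
    by_contra hcon
    push Not at hcon
    have h6 := hgap s t h1 hcon.2 hcon.1 (hX.mono' hl.le h4) (hX.mono' hl.le h5)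
    exact hpX (hX.mono' hl (hX.up l s pu t p h6.1 h6.2 h2 h3 h4 h5 hpu))
  · intro l hl s t h1 h2 h3 h4 h5
    refine Has.swap H hH T1 R T2 _ hR hRn ?_ (hT.hasY l (by omega) s t h1 h2 h3 h4 h5)
    by_contra hcon
    push Not at hcon
    refine nc i l (by omega) z s (by omega) (by omega) hz.2.2 h4 ?_
    have := segeq z hz.1 hz.2.1
    have := hseg hcon.1.le
    have := hseg hcon.2.le
    omega
  · intro v v' hv hv' hf
    rcases hE _ hf with hf | hf
    · refine hT.avoid v v' hv ?_ hf
      rcases hv' with h | h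
      · exact Or.inl (hX.mono _ h)
      · exact Or.inr h
    · exact hQv v (w.fst_mem_support_of_mem_edges hf) hv'
  · intro v hv hv'
    simp only [Walk.mem_support_append_iff, Walk.support_mapLe_eq_support, Walk.support_reverse,
      List.mem_reverse] at hv
    have := hT.vert v
    simp only [Walk.mem_support_append_iff] at this
    rcases hv with (hv | hv) | hv
    · tauto
    · exfalso
      refine hQv v hv ?_
      rcases hv' with h | h
      · exact Or.inl (hX.mono' (Nat.zero_le _) h)
      · exact Or.inr (hY.mono' (Nat.zero_le _) h)
    · tauto
  · intro f hf
    rcases hE _ hf with hf | hf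
    · exact hT.sub f hf
    · exact Or.inr (hQN f hf)

lemma hop_step {N : SimpleGraph V} (hNG : N ≤ G) {H : G.Walk x x} (hH : H.IsTrail) {seg : ℕ → ℕ}
    (hseg : Monotone seg) {M : Set (Sym2 V)}
    (hM : ∀ s t, s ≤ t → seg s = seg t → ∀ d ∈ dS H s t, d.edge ∉ M)
    {X Y : ℕ → Set V} (hX : Lev N H seg X) (hY : Lev N H seg Y) {i j : ℕ}
    (nc : ∀ i' j', i' + j' < i + 1 + j → ∀ s t, s ≤ H.length → t ≤ H.length →
      H.getVert s ∈ X i' → H.getVert t ∈ Y j' → seg s ≠ seg t)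
    {q p : V} (T : G.Walk q p) (hT : HopInv N H seg M X Y (i + 1) j T) :
    ∃ p', ∃ T' : G.Walk q p', HopInv N H seg M X Y i j T' := by
  classical
  by_cases hpX : p ∈ X i
  · refine ⟨p, T, hT.trail, hT.marks, hpX, hT.hq, fun l hl => hT.hasX l (by omega), hT.hasY, ?_,
      hT.vert, hT.sub⟩
    intro v w h1 h2
    refine hT.avoid v w h1 ?_
    rcases h2 with h | h
    · exact Or.inl (hX.mono _ h)
    · exact Or.inr h
  rcases hX.down i p hT.hp with h | ⟨s, u, t, hsu, hut, htl, hst, hs, ht, hup⟩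
  · exact absurd h hpX
  have huX : H.getVert u ∉ X i := fun h => hpX (hX.closed _ _ _ h hup)
  have hsu' : s < u := lt_of_le_of_ne hsu (by rintro rfl; exact huX hs)
  have hut' : u < t := lt_of_le_of_ne hut (by rintro rfl; exact huX ht)
  have segeq : ∀ r, s ≤ r → r ≤ t → seg r = seg s := by
    intro r h1 h2
    have := hseg h1; have := hseg h2; omega
  rcases hT.hasX i (by omega) s t (by omega) htl hst hs ht with hin | hin
  · -- forward
    have hex : ∃ r, u < r ∧ H.getVert r ∈ X i := ⟨t, hut', ht⟩
    let r := Nat.find hex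
    have hr : u < r ∧ H.getVert r ∈ X i := Nat.find_spec hex
    have hrt : r ≤ t := Nat.find_min' hex ⟨hut', ht⟩
    have hrmin : ∀ m, u < m → m < r → H.getVert m ∉ X i := fun m h1 h2 h3 =>
      Nat.find_min hex h2 ⟨h1, h3⟩
    have hdn : (dS H u r) ≠ [] := by
      intro h
      have := congrArg List.length h
      simp [dS] at this
      omega
    have hnn : ¬ (sl H u r hr.1.le).Nil := by
      rw [← Walk.darts_eq_nil, sl_darts]; exact hdn
    have hsub : (sl H u r hr.1.le).IsSubwalk T := by
      rw [Walk.isSubwalk_iff_darts_isInfix hnn, sl_darts]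
      exact (dS_contig H hsu hr.1.le hrt).trans hin
    obtain ⟨T1, T2, rfl⟩ := hsub
    refine ⟨H.getVert r, hop_core hNG hH hseg hM hX hY nc (lo := u) (hi := r) (z := r) T1
      (sl H u r hr.1.le) T2 hT hpX hup hr.2 (by omega) hr.1 ?_ le_rfl hr.1.le
      ⟨hr.1.le, le_rfl, hr.2⟩ ?_ ?_ ?_⟩
    · rw [segeq u (by omega) (by omega), segeq r (by omega) (by omega)]
    · intro d hd
      rw [sl_darts] at hd
      exact ⟨d, hd, rfl⟩
    · rw [sl_darts]; exact hdn
    · intro a b h1 h2 h3 h4 h5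
      refine ⟨?_, by omega⟩
      by_contra hcon
      exact hrmin a (by omega) h2 h4
  · -- backward
    let P : ℕ → Prop := fun m => m < u ∧ H.getVert m ∈ X i
    have hPs : P s := ⟨hsu', hs⟩
    let r := Nat.findGreatest P u
    have hr : r < u ∧ H.getVert r ∈ X i := Nat.findGreatest_spec (P := P) hsu'.le hPs
    have hsr : s ≤ r := Nat.le_findGreatest hsu'.le hPs
    have hrmax : ∀ m, r < m → m < u → H.getVert m ∉ X i := fun m h1 h2 h3 =>
      Nat.findGreatest_is_greatest (P := P) h1 h2.le ⟨h2, h3⟩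
    have hdn : (dS H r u) ≠ [] := by
      intro h
      have := congrArg List.length h
      simp [dS] at this
      omega
    have hrd : ((sl H r u hr.1.le).reverse).darts = revD (dS H r u) := by
      rw [darts_reverse_revD, sl_darts]
    have hrn : revD (dS H r u) ≠ [] := by
      simpa [revD] using hdn
    have hnn : ¬ ((sl H r u hr.1.le).reverse).Nil := by
      rw [← Walk.darts_eq_nil, hrd]; exact hrn
    have hsub : ((sl H r u hr.1.le).reverse).IsSubwalk T := by
      rw [Walk.isSubwalk_iff_darts_isInfix hnn, hrd]
      exact (revD_contig (dS_contig H hsr hr.1.le hut)).trans hin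
    obtain ⟨T1, T2, rfl⟩ := hsub
    refine ⟨H.getVert r, hop_core hNG hH hseg hM hX hY nc (lo := r) (hi := u) (z := r) T1
      ((sl H r u hr.1.le).reverse) T2 hT hpX hup hr.2 (by omega) hr.1 ?_ hr.1.le le_rfl
      ⟨le_rfl, hr.1.le, hr.2⟩ ?_ ?_ ?_⟩
    · rw [segeq u (by omega) (by omega), segeq r (by omega) (by omega)]
    · intro d hd
      rw [hrd, mem_revD] at hd
      exact ⟨d.symm, hd, by simp⟩
    · rw [hrd]; exact hrn
    · intro a b h1 h2 h3 h4 h5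
      refine ⟨by omega, ?_⟩
      by_contra hcon
      exact hrmax b (by omega) (by omega) h5

lemma hop_all {N : SimpleGraph V} (hNG : N ≤ G) {H : G.Walk x x} (hH : H.IsTrail) {seg : ℕ → ℕ}
    (hseg : Monotone seg) {M : Set (Sym2 V)}
    (hM : ∀ s t, s ≤ t → seg s = seg t → ∀ d ∈ dS H s t, d.edge ∉ M) (i : ℕ) :
    ∀ (j : ℕ) {X Y : ℕ → Set V} (_ : Lev N H seg X) (_ : Lev N H seg Y)
    (_ : ∀ i' j', i' + j' < i + j → ∀ s t, s ≤ H.length → t ≤ H.length →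
      H.getVert s ∈ X i' → H.getVert t ∈ Y j' → seg s ≠ seg t)
    {q p : V} (T : G.Walk q p) (_ : HopInv N H seg M X Y i j T),
    ∃ q' p', ∃ T' : G.Walk q' p', HopInv N H seg M X Y 0 0 T' := by
  induction i with
  | zero =>
    intro j
    induction j with
    | zero => intro X Y _ _ _ q p T hT; exact ⟨q, p, T, hT⟩
    | succ j ih =>
      intro X Y hX hY nc q p T hT
      obtain ⟨p', T', hT'⟩ := hop_step hNG hH hseg hM hY hX (i := j) (j := 0)
        (fun i' j' h s t h1 h2 h3 h4 h5 => nc j' i' (by omega) t s h2 h1 h4 h3 h5.symm) _ hT.symm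
      exact ih hX hY (fun i' j' h => nc i' j' (by omega)) _ hT'.symm
  | succ i ih =>
    intro j X Y hX hY nc q p T hT
    obtain ⟨p', T', hT'⟩ := hop_step hNG hH hseg hM hX hY nc _ hT
    exact ih j hX hY (fun i' j' h => nc i' j' (by omega)) _ hT'

lemma hop_init {N : SimpleGraph V} {H : G.Walk x x} (hH : H.IsTrail)
    (hNH : ∀ v w, N.Adj v w → s(v, w) ∉ H.edges) {seg : ℕ → ℕ}
    (hseg : Monotone seg) {M : Set (Sym2 V)} (hMH : ∀ m ∈ M, m ∈ H.edges)
    (hM : ∀ s t, s ≤ t → seg s = seg t → ∀ d ∈ dS H s t, d.edge ∉ M)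
    {X Y : ℕ → Set V} {i j : ℕ}
    (nc : ∀ i' j', i' + j' < i + j → ∀ s t, s ≤ H.length → t ≤ H.length →
      H.getVert s ∈ X i' → H.getVert t ∈ Y j' → seg s ≠ seg t)
    {s t : ℕ} (hst : s ≤ t) (ht : t ≤ H.length) (hs : seg s = seg t) (hsX : H.getVert s ∈ X i)
    (htY : H.getVert t ∈ Y j) :
    HopInv N H seg M X Y i j ((H.drop t).append (H.take s)) := by
  have hE : ∀ f ∈ ((H.drop t).append (H.take s)).edges, f ∈ H.edges := by
    intro f hf
    simp only [Walk.edges_append, Walk.edges_drop, Walk.edges_take, List.mem_append] at hf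
    rcases hf with h | h
    · exact List.mem_of_mem_drop h
    · exact List.mem_of_mem_take h
  have hHas : ∀ s' t', t' ≤ H.length → s' < t' → (t' ≤ s ∨ t ≤ s') →
      Has H ((H.drop t).append (H.take s)) s' t' := by
    intro s' t' h1 h2 h3
    left
    rw [Walk.darts_append, Walk.darts_drop, Walk.darts_take]
    rcases h3 with h3 | h3
    · have : H.darts.take s = dS H 0 s := by simp [dS]
      rw [this]
      exact (dS_contig H (Nat.zero_le _) h2.le h3).trans (List.suffix_append _ _).isInfix
    · have : H.darts.drop t = dS H t H.length := by
        unfold dS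
        rw [List.take_of_length_le]
        simp
      rw [this]
      exact (dS_contig H h3 h2.le h1).trans (List.prefix_append _ _).isInfix
  have hov : ∀ s' t', s' < t' → seg s' = seg t' → ¬ (t' ≤ s ∨ t ≤ s') → seg s' = seg s := by
    intro s' t' h1 h2 h3
    push Not at h3
    have := hseg h3.1.le
    have := hseg h3.2.le
    omega
  constructor
  · rw [Walk.isTrail_def]
    simp only [Walk.edges_append, Walk.edges_drop, Walk.edges_take]
    have hn := hH.edges_nodup
    have h1 : (H.edges.take t ++ H.edges.drop t).Nodup := by rwa [List.take_append_drop]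
    rw [List.nodup_append] at h1 ⊢
    refine ⟨h1.2.1, hn.sublist (List.take_sublist _ _), fun a ha b hb e => ?_⟩
    refine h1.2.2 b ?_ a ha e.symm
    exact (List.take_prefix_take_left hst).subset hb
  · intro m hm
    have h1 := hMH m hm
    simp only [Walk.edges_append, Walk.edges_drop, Walk.edges_take, List.mem_append]
    rw [← List.take_append_drop t H.edges, List.mem_append] at h1
    rcases h1 with h1 | h1
    · right
      rw [← List.take_append_drop s (H.edges.take t), List.mem_append, List.take_take,
        min_eq_left hst, List.drop_take] at h1
      rcases h1 with h1 | h1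
      · exact h1
      · exfalso
        unfold Walk.edges at h1
        rw [← List.map_drop, ← List.map_take, List.mem_map] at h1
        obtain ⟨d, hd, rfl⟩ := h1
        exact hM s t hst hs d hd hm
    · left; exact h1
  · exact hsX
  · exact htY
  · intro l hl s' t' h1 h2 h3 h4 h5
    refine hHas s' t' h2 h1 ?_
    by_contra hcon
    exact nc l j (by omega) s' t (by omega) ht h4 htY ((hov s' t' h1 h3 hcon).trans hs)
  · intro l hl s' t' h1 h2 h3 h4 h5
    refine hHas s' t' h2 h1 ?_
    by_contra hcon
    exact nc i l (by omega) s s' (by omega) (by omega) hsX h4 (hov s' t' h1 h3 hcon).symm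
  · intro v w h1 h2 h3
    exact hNH v w h1 (hE _ h3)
  · intro v hv _
    rw [Walk.mem_support_append_iff] at hv
    rcases hv with h | h
    · exact (H.isSubwalk_drop t).support_subset h
    · exact (H.isSubwalk_take s).support_subset h
  · intro f hf; exact Or.inl (hE f hf)

lemma hop_close {N : SimpleGraph V} [DecidableEq V] (hNG : N ≤ G) {H : G.Walk x x} {seg : ℕ → ℕ}
    {M : Set (Sym2 V)} {X Y : ℕ → Set V} {a b : V} (hab : G.Adj a b)
    (hX0 : X 0 = {v | N.Reachable a v}) (hY0 : Y 0 = {v | N.Reachable b v})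
    (hnab : ¬ N.Reachable a b) (habN : ¬ N.Adj a b) (habH : s(a, b) ∉ H.edges)
    {q p : V} (T : G.Walk q p) (hT : HopInv N H seg M X Y 0 0 T) :
    ∃ (y : V) (c : G.Walk y y), c.IsCircuit ∧ (∀ m ∈ M, m ∈ c.edges) ∧
      s(a, b) ∈ c.edges ∧
      (a ∉ H.support → c.support.tail.count a = 1) ∧
      (b ∉ H.support → c.support.tail.count b = 1) := by
  have hp : N.Reachable a p := by have := hT.hp; rwa [hX0] at this
  have hq : N.Reachable b q := by have := hT.hq; rwa [hY0] at this
  obtain ⟨A, hA⟩ := hp.symm.exists_isPath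
  obtain ⟨B, hB⟩ := hq.exists_isPath
  have hAr : ∀ v ∈ A.support, N.Reachable a v := fun v hv => ⟨(A.dropUntil v hv).reverse⟩
  have hBr : ∀ v ∈ B.support, N.Reachable b v := fun v hv => ⟨B.takeUntil v hv⟩
  have hAB : ∀ v ∈ A.support, v ∉ B.support := fun v h1 h2 =>
    hnab ((hAr v h1).trans (hBr v h2).symm)
  have hTA : ∀ f ∈ A.edges, f ∉ T.edges := by
    intro f hf
    induction f with
    | h v w =>
    refine hT.avoid v w (A.edges_subset_edgeSet hf) (Or.inl ?_)
    rw [hX0]; exact hAr v (A.fst_mem_support_of_mem_edges hf)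
  have hTB : ∀ f ∈ B.edges, f ∉ T.edges := by
    intro f hf
    induction f with
    | h v w =>
    refine hT.avoid v w (B.edges_subset_edgeSet hf) (Or.inr ?_)
    rw [hY0]; exact hBr v (B.fst_mem_support_of_mem_edges hf)
  have hABe : ∀ f ∈ A.edges, f ∉ B.edges := by
    intro f hf
    induction f with
    | h v w =>
    intro h
    exact hAB v (A.fst_mem_support_of_mem_edges hf) (B.fst_mem_support_of_mem_edges h)
  have habT : s(a, b) ∉ T.edges := fun h => by
    rcases hT.sub _ h with h | h
    · exact habH h
    · exact habN h
  have habA : s(a, b) ∉ A.edges := fun h => habN (A.edges_subset_edgeSet h)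
  have habB : s(a, b) ∉ B.edges := fun h => habN (B.edges_subset_edgeSet h)
  have hc : (T.append ((A.mapLe hNG).append (Walk.cons hab (B.mapLe hNG)))).edges
      = T.edges ++ (A.edges ++ s(a, b) :: B.edges) := by
    simp [Walk.edges_append]
  have hs : (T.append ((A.mapLe hNG).append (Walk.cons hab (B.mapLe hNG)))).support.tail
      = T.support.tail ++ (A.support.tail ++ B.support) := by
    rw [Walk.tail_support_append, Walk.tail_support_append]
    simp
  refine ⟨q, T.append ((A.mapLe hNG).append (Walk.cons hab (B.mapLe hNG))), ⟨⟨?_⟩, ?_⟩, ?_, ?_, ?_, ?_⟩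
  · rw [hc]
    have h1 := hT.trail.edges_nodup
    have h2 := hA.isTrail.edges_nodup
    have h3 := hB.isTrail.edges_nodup
    simp only [List.nodup_append, List.nodup_cons, List.mem_append, List.mem_cons]
    grind
  · intro h
    have := congrArg Walk.edges h
    rw [hc] at this
    simp at this
  · intro m hm
    rw [hc]
    have := hT.marks m hm
    simp [this]
  · rw [hc]; simp
  · intro haH
    have haT : a ∉ T.support := fun h => haH (hT.vert a h (Or.inl (by rw [hX0]; exact Reachable.refl a)))
    have hpa : p ≠ a := by rintro rfl; exact haT T.end_mem_support
    have h1 : a ∉ B.support := fun h => hAB a A.end_mem_support h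
    have h2 : A.support.count a = 1 := List.count_eq_one_of_mem hA.support_nodup A.end_mem_support
    rw [Walk.support_eq_cons, List.count_cons_of_ne hpa] at h2
    rw [hs, List.count_append, List.count_append, h2, List.count_eq_zero_of_not_mem h1,
      List.count_eq_zero_of_not_mem (fun h => haT (List.mem_of_mem_tail h))]
  · intro hbH
    have hbT : b ∉ T.support := fun h => hbH (hT.vert b h (Or.inr (by rw [hY0]; exact Reachable.refl b)))
    have h1 : b ∉ A.support := fun h => hAB b h B.start_mem_support
    have h2 : B.support.count b = 1 := List.count_eq_one_of_mem hB.support_nodup B.start_mem_support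
    rw [hs, List.count_append, List.count_append, h2,
      List.count_eq_zero_of_not_mem (fun h => h1 (List.mem_of_mem_tail h)),
      List.count_eq_zero_of_not_mem (fun h => hbT (List.mem_of_mem_tail h))]

/-- The chain of vertex sets. -/
def levSet (N : SimpleGraph V) (H : G.Walk x x) (seg : ℕ → ℕ) (a : V) : ℕ → Set V
  | 0 => {v | N.Reachable a v}
  | l + 1 => {p | p ∈ levSet N H seg a l ∨ ∃ s u t, s ≤ u ∧ u ≤ t ∧ t ≤ H.length ∧ seg s = seg t ∧
      H.getVert s ∈ levSet N H seg a l ∧ H.getVert t ∈ levSet N H seg a l ∧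
      N.Reachable (H.getVert u) p}

lemma levSet_lev (N : SimpleGraph V) (H : G.Walk x x) (seg : ℕ → ℕ) (a : V) :
    Lev N H seg (levSet N H seg a) where
  mono := fun l v hv => Or.inl hv
  closed := by
    intro l
    induction l with
    | zero => intro v w h1 h2; exact Reachable.trans h1 h2
    | succ l ih =>
      rintro v w (h1 | ⟨s, u, t, h1, h2, h3, h4, h5, h6, h7⟩) h
      · exact Or.inl (ih v w h1 h)
      · exact Or.inr ⟨s, u, t, h1, h2, h3, h4, h5, h6, h7.trans h⟩
  up := fun l s u t p h1 h2 h3 h4 h5 h6 h7 => Or.inr ⟨s, u, t, h1, h2, h3, h4, h5, h6, h7⟩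
  down := fun l p h => h

lemma edges_getElem_eq {y : V} (H : G.Walk x y) (i : ℕ) (hi : i < H.edges.length) :
    H.edges[i] = s(H.getVert i, H.getVert (i + 1)) := by
  induction H generalizing i with
  | nil => simp at hi
  | cons h p ih =>
    cases i with
    | zero => simp
    | succ i => simpa using ih i (by simpa using hi)

open Classical in
/-- positions where `H` enters `X` -/
noncomputable def ups (H : G.Walk x x) (X : Set V) : Finset ℕ :=
  (Finset.range H.length).filter (fun i => H.getVert i ∉ X ∧ H.getVert (i + 1) ∈ X)

lemma mem_ups {H : G.Walk x x} {X : Set V} {i : ℕ} :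
    i ∈ ups H X ↔ i < H.length ∧ H.getVert i ∉ X ∧ H.getVert (i + 1) ∈ X := by
  simp [ups]

lemma cut_ncard {H : G.Walk x x} (hH : H.IsTrail) {X : Set V} {a b : V} (hab : G.Adj a b)
    (haX : a ∈ X) (hbX : b ∉ X) (habH : s(a, b) ∉ H.edges)
    (hcl : ∀ v w, G.Adj v w → v ∈ X → w ∉ X → s(v, w) ∈ H.edges ∨ s(v, w) = s(a, b)) :
    (edgeCut G X).ncard = 2 * (ups H X).card + 1 := by
  classical
  set dn : Finset ℕ := (Finset.range H.length).filter
    (fun i => H.getVert i ∈ X ∧ H.getVert (i + 1) ∉ X) with hdn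
  have hlen : H.edges.length = H.length := by simp
  -- up = down
  have hud : (ups H X).card = dn.card := by
    have h0 : ∑ i ∈ Finset.range H.length,
        ((if H.getVert (i + 1) ∈ X then (1 : ℤ) else 0) - (if H.getVert i ∈ X then 1 else 0)) = 0 := by
      rw [Finset.sum_range_sub (fun i => if H.getVert i ∈ X then (1 : ℤ) else 0)]
      simp
    have h1 : ∀ i, ((if H.getVert (i + 1) ∈ X then (1 : ℤ) else 0) - (if H.getVert i ∈ X then 1 else 0))
        = (if H.getVert i ∉ X ∧ H.getVert (i + 1) ∈ X then 1 else 0)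
          - (if H.getVert i ∈ X ∧ H.getVert (i + 1) ∉ X then 1 else 0) := by
      intro i
      by_cases h : H.getVert i ∈ X <;> by_cases h' : H.getVert (i + 1) ∈ X <;> simp [h, h']
    simp_rw [h1, Finset.sum_sub_distrib, Finset.sum_boole] at h0
    have : ((ups H X).card : ℤ) = dn.card := by
      unfold ups; rw [hdn]; linarith
    exact_mod_cast this
  have hdisj : Disjoint (ups H X) dn := by
    rw [Finset.disjoint_left]
    intro i h1 h2
    rw [mem_ups] at h1
    rw [hdn, Finset.mem_filter] at h2
    exact h1.2.1 h2.2.1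
  let f : ℕ → Sym2 V := fun i => s(H.getVert i, H.getVert (i + 1))
  have hfm : ∀ i < H.length, f i ∈ H.edges := by
    intro i hi
    show s(H.getVert i, H.getVert (i + 1)) ∈ H.edges
    rw [← edges_getElem_eq H i (by omega)]
    exact List.getElem_mem _
  have hinj : Set.InjOn f ((ups H X ∪ dn : Finset ℕ) : Set ℕ) := by
    have hlt : ∀ i ∈ ups H X ∪ dn, i < H.length := by
      intro i hi
      rw [Finset.mem_union, mem_ups, hdn, Finset.mem_filter, Finset.mem_range] at hi
      tauto
    intro i hi j hj e
    have hi' := hlt i hi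
    have hj' := hlt j hj
    have e' : H.edges[i]'(by omega) = H.edges[j]'(by omega) := by
      rw [edges_getElem_eq H i (by omega), edges_getElem_eq H j (by omega)]
      exact e
    exact (List.Nodup.getElem_inj_iff hH.edges_nodup).1 e'
  have hset : edgeCut G X = ((insert s(a, b) ((ups H X ∪ dn).image f) : Finset (Sym2 V)) : Set (Sym2 V)) := by
    ext g
    simp only [Finset.coe_insert, Set.mem_insert_iff, Finset.coe_image, Set.mem_image, Finset.mem_coe,
      Finset.mem_union, mem_ups, hdn, Finset.mem_filter, Finset.mem_range]
    constructor
    · rintro ⟨v, w, h1, h2, h3, rfl⟩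
      rcases hcl v w h1 h2 h3 with h | h
      · right
        obtain ⟨i, hi, e⟩ := List.mem_iff_getElem.1 h
        rw [edges_getElem_eq H i hi] at e
        refine ⟨i, ?_, e⟩
        rw [Sym2.eq_iff] at e
        rcases e with ⟨e1, e2⟩ | ⟨e1, e2⟩
        · right; rw [e1, e2]; exact ⟨by omega, h2, h3⟩
        · left; rw [e1, e2]; exact ⟨by omega, h3, h2⟩
      · exact Or.inl h
    · rintro (rfl | ⟨i, (⟨h1, h2, h3⟩ | ⟨h1, h2, h3⟩), rfl⟩)
      · exact ⟨a, b, hab, haX, hbX, rfl⟩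
      · exact ⟨_, _, (H.adj_getVert_succ h1).symm, h3, h2, Sym2.eq_swap⟩
      · exact ⟨_, _, H.adj_getVert_succ h1, h2, h3, rfl⟩
  rw [hset, Set.ncard_coe_finset, Finset.card_insert_of_notMem, Finset.card_image_of_injOn hinj,
    Finset.card_union_of_disjoint hdisj]
  · omega
  · intro h
    obtain ⟨i, hi, e⟩ := Finset.mem_image.1 h
    apply habH
    rw [← e]
    apply hfm
    rw [Finset.mem_union, mem_ups, hdn, Finset.mem_filter, Finset.mem_range] at hi
    tauto

lemma ups_count {H : G.Walk x x} {seg : ℕ → ℕ} (hseg : Monotone seg) {X Y : Set V}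
    (hXX : ∀ s u t, s ≤ u → u ≤ t → t ≤ H.length → seg s = seg t → H.getVert s ∈ X →
      H.getVert t ∈ X → H.getVert u ∈ X)
    (hYY : ∀ s u t, s ≤ u → u ≤ t → t ≤ H.length → seg s = seg t → H.getVert s ∈ Y →
      H.getVert t ∈ Y → H.getVert u ∈ Y)
    (nc : ∀ s t, s ≤ H.length → t ≤ H.length → H.getVert s ∈ X → H.getVert t ∈ Y → seg s ≠ seg t) :
    (ups H X).card + (ups H Y).card ≤ (Finset.Icc (seg 1) (seg H.length)).card := by
  classical
  have hdisj : Disjoint (ups H X) (ups H Y) := by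
    rw [Finset.disjoint_left]
    intro i h1 h2
    rw [mem_ups] at h1 h2
    exact nc (i + 1) (i + 1) (by omega) (by omega) h1.2.2 h2.2.2 rfl
  rw [← Finset.card_union_of_disjoint hdisj]
  refine Finset.card_le_card_of_injOn (fun i => seg (i + 1)) ?_ ?_
  · intro i hi
    simp only [Finset.coe_union, Set.mem_union, Finset.mem_coe, mem_ups] at hi
    simp only [Finset.coe_Icc, Set.mem_Icc]
    exact ⟨hseg (by omega), hseg (by omega)⟩
  · have key : ∀ i j, i < j → i ∈ ups H X ∪ ups H Y → j ∈ ups H X ∪ ups H Y →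
        seg (i + 1) = seg (j + 1) → False := by
      intro i j hij hi hj e
      rw [Finset.mem_union, mem_ups, mem_ups] at hi hj
      rcases hi with ⟨h1, h2, h3⟩ | ⟨h1, h2, h3⟩ <;> rcases hj with ⟨h4, h5, h6⟩ | ⟨h4, h5, h6⟩
      · exact h5 (hXX (i + 1) j (j + 1) (by omega) (by omega) (by omega) e h3 h6)
      · exact nc _ _ (by omega) (by omega) h3 h6 e
      · exact nc _ _ (by omega) (by omega) h6 h3 e.symm
      · exact h5 (hYY (i + 1) j (j + 1) (by omega) (by omega) (by omega) e h3 h6)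
    intro i hi j hj e
    rcases lt_trichotomy i j with h | h | h
    · exact (key i j h hi hj e).elim
    · exact h
    · exact (key j i h hj hi e.symm).elim

/-- main argument, for a circuit whose first edge is prescribed (if there is any) -/
lemma hop_main [DecidableEq V] (k : ℕ) (hcut : ¬ HasOddCutLE G (k + 1)) {M : Set (Sym2 V)}
    (hMk : ∀ L : List (Sym2 V), L.Nodup → (∀ m ∈ L, m ∈ M) → L.length ≤ k)
    {a b : V} (hab : G.Adj a b) (H : G.Walk x x) (hH : H.IsTrail) (hMH : ∀ m ∈ M, m ∈ H.edges)
    (hfirst : k = 0 ∨ ∃ h : 0 < H.edges.length, H.edges[0] ∈ M) (habH : s(a, b) ∉ H.edges)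
    (hbr : ¬ (G.deleteEdges ({f | f ∈ H.edges} ∪ {s(a, b)})).Reachable a b) :
    ∃ (y : V) (c : G.Walk y y), c.IsCircuit ∧ (∀ m ∈ M, m ∈ c.edges) ∧
      s(a, b) ∈ c.edges ∧
      (a ∉ H.support → c.support.tail.count a = 1) ∧
      (b ∉ H.support → c.support.tail.count b = 1) := by
  classical
  set N := G.deleteEdges ({f | f ∈ H.edges} ∪ {s(a, b)}) with hN
  have hNG : N ≤ G := G.deleteEdges_le _
  have hNadj : ∀ v w, N.Adj v w ↔ G.Adj v w ∧ s(v, w) ∉ H.edges ∧ s(v, w) ≠ s(a, b) := by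
    intro v w
    rw [hN, deleteEdges_adj]
    simp only [Set.mem_union, Set.mem_setOf_eq, Set.mem_singleton_iff, not_or]
  have habN : ¬ N.Adj a b := fun h => ((hNadj a b).1 h).2.2 rfl
  have hNH : ∀ v w, N.Adj v w → s(v, w) ∉ H.edges := fun v w h => ((hNadj v w).1 h).2.1
  let seg : ℕ → ℕ := fun i => (H.edges.take i).countP (fun f => decide (f ∈ M))
  have hseg : Monotone seg := by
    intro i j hij
    exact (List.take_prefix_take_left hij).sublist.countP_le
  have hM : ∀ s t, s ≤ t → seg s = seg t → ∀ d ∈ dS H s t, d.edge ∉ M := by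
    intro s t hst e d hd hdM
    have h1 : H.edges.take t = H.edges.take s ++ (dS H s t).map Dart.edge := by
      have : t = s + (t - s) := by omega
      conv_lhs => rw [this, List.take_add]
      simp [dS, Walk.edges, List.map_take, List.map_drop]
    have h2 : seg t = seg s + ((dS H s t).map Dart.edge).countP (fun f => decide (f ∈ M)) := by
      simp only [seg]
      rw [h1, List.countP_append]
    have h3 : 0 < ((dS H s t).map Dart.edge).countP (fun f => decide (f ∈ M)) := by
      rw [List.countP_pos_iff]
      exact ⟨d.edge, List.mem_map_of_mem hd, by simpa using hdM⟩
    omega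
  have hsegk : seg H.length ≤ k := by
    simp only [seg]
    rw [List.countP_eq_length_filter]
    refine hMk _ ((hH.edges_nodup.sublist (List.take_sublist _ _)).filter _) ?_
    intro m hm
    have := (List.mem_filter.1 hm).2
    simpa using this
  set X := levSet N H seg a with hXd
  set Y := levSet N H seg b with hYd
  have hX : Lev N H seg X := levSet_lev N H seg a
  have hY : Lev N H seg Y := levSet_lev N H seg b
  -- some connection exists
  have hconn : ∃ n, ∃ i j s t, i + j = n ∧ s ≤ H.length ∧ t ≤ H.length ∧ H.getVert s ∈ X i ∧
      H.getVert t ∈ Y j ∧ seg s = seg t := by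
    by_contra hno
    have nc : ∀ i j s t, s ≤ H.length → t ≤ H.length → H.getVert s ∈ X i → H.getVert t ∈ Y j →
        seg s ≠ seg t := fun i j s t h1 h2 h3 h4 h5 => hno ⟨_, i, j, s, t, rfl, h1, h2, h3, h4, h5⟩
    have haux : ∀ (X : ℕ → Set V) (c : V), X 0 = {v | N.Reachable c v} → Lev N H seg X → ∀ d,
        ¬ N.Reachable c d → (∀ i s t, s ≤ H.length → t ≤ H.length → H.getVert s ∈ X i →
          N.Reachable d (H.getVert t) → seg s ≠ seg t) → ∀ l, d ∉ X l := by
      intro X c hX0 hX d hcd hn l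
      induction l with
      | zero => rw [hX0]; exact hcd
      | succ l ih =>
        intro hd
        rcases hX.down l d hd with h | ⟨s, u, t, h1, h2, h3, h4, h5, h6, h7⟩
        · exact ih h
        · refine hn l s u (by omega) (by omega) h5 h7.symm ?_
          have := hseg h1; have := hseg h2; omega
    have hbX : ∀ l, b ∉ X l := haux X a rfl hX b hbr
      (fun i s t h1 h2 h3 h4 => nc i 0 s t h1 h2 h3 h4)
    have haY : ∀ l, a ∉ Y l := haux Y b rfl hY a (fun h => hbr h.symm)
      (fun i s t h1 h2 h3 h4 h5 => nc 0 i t s h2 h1 h4 h3 h5.symm)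
    have hconv : ∀ (X : ℕ → Set V), Lev N H seg X → ∀ s u t, s ≤ u → u ≤ t → t ≤ H.length →
        seg s = seg t → H.getVert s ∈ (⋃ l, X l) → H.getVert t ∈ (⋃ l, X l) →
        H.getVert u ∈ (⋃ l, X l) := by
      intro X hX s u t h1 h2 h3 h4 h5 h6
      rw [Set.mem_iUnion] at h5 h6 ⊢
      obtain ⟨l, h5⟩ := h5
      obtain ⟨m, h6⟩ := h6
      exact ⟨max l m + 1, hX.up _ s u t _ h1 h2 h3 h4 (hX.mono' (le_max_left _ _) h5)
        (hX.mono' (le_max_right _ _) h6) (Reachable.refl _)⟩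
    have hcard : ∀ (X : ℕ → Set V) (c d : V), Lev N H seg X → c ∈ X 0 → (∀ l, d ∉ X l) →
        G.Adj c d → s(c, d) = s(a, b) → k + 1 ≤ 2 * (ups H (⋃ l, X l)).card := by
      intro X c d hX hc hd hcd he
      have h1 : (edgeCut G (⋃ l, X l)).ncard = 2 * (ups H (⋃ l, X l)).card + 1 := by
        refine cut_ncard hH hcd (Set.mem_iUnion.2 ⟨0, hc⟩) ?_ (he ▸ habH) ?_
        · rw [Set.mem_iUnion]; rintro ⟨l, hl⟩; exact hd l hl
        · intro v w hvw hv hw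
          by_contra hcon
          push Not at hcon
          obtain ⟨l, hv⟩ := Set.mem_iUnion.1 hv
          refine hw (Set.mem_iUnion.2 ⟨l, hX.closed l v w hv (Adj.reachable ?_)⟩)
          rw [hNadj]
          exact ⟨hvw, hcon.1, he ▸ hcon.2⟩
      by_contra hcon
      exact hcut ⟨_, ⟨(ups H (⋃ l, X l)).card, h1⟩, by omega⟩
    have h1 := hcard X a b hX (Reachable.refl a) hbX hab rfl
    have h2 := hcard Y b a hY (Reachable.refl b) haY hab.symm Sym2.eq_swap
    have h3 := ups_count (H := H) hseg (hconv X hX) (hconv Y hY) (by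
      intro s t h1 h2 h3 h4
      obtain ⟨i, h3⟩ := Set.mem_iUnion.1 h3
      obtain ⟨j, h4⟩ := Set.mem_iUnion.1 h4
      exact nc i j s t h1 h2 h3 h4)
    rw [Nat.card_Icc] at h3
    rcases hfirst with h0 | ⟨h0, h0'⟩
    · omega
    · have : 1 ≤ seg 1 := by
        simp only [seg]
        rw [Nat.one_le_iff_ne_zero, ← Nat.pos_iff_ne_zero, List.countP_pos_iff]
        refine ⟨H.edges[0], ?_, by simpa using h0'⟩
        rw [List.mem_take_iff_getElem]
        exact ⟨0, by omega, rfl⟩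
      omega
  -- minimal connection
  obtain ⟨i, j, s, t, hij, hs, ht, hsX, htY, hst⟩ := Nat.find_spec hconn
  have nc : ∀ i' j', i' + j' < i + j → ∀ s t, s ≤ H.length → t ≤ H.length →
      H.getVert s ∈ X i' → H.getVert t ∈ Y j' → seg s ≠ seg t := by
    intro i' j' hlt s t h1 h2 h3 h4 h5
    rw [hij] at hlt
    exact Nat.find_min hconn hlt ⟨i', j', s, t, rfl, h1, h2, h3, h4, h5⟩
  have hinit : ∃ q p, ∃ T : G.Walk q p, HopInv N H seg M X Y i j T := by
    rcases le_total s t with h | h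
    · exact ⟨_, _, _, hop_init hH hNH hseg hMH hM nc h ht hst hsX htY⟩
    · have := hop_init (i := j) (j := i) hH hNH hseg hMH hM
        (fun i' j' h s t h1 h2 h3 h4 h5 => nc j' i' (by omega) t s h2 h1 h4 h3 h5.symm)
        h hs hst.symm htY hsX
      exact ⟨_, _, _, this.symm⟩
  obtain ⟨q, p, T, hT⟩ := hinit
  obtain ⟨q', p', T', hT'⟩ := hop_all hNG hH hseg hM i j hX hY nc T hT
  exact hop_close hNG hab rfl rfl hbr habN habH T' hT'

end hop

theorem stmt8 {V : Type*} [Fintype V] [DecidableEq V] (G : SimpleGraph V) (k : ℕ)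
    (hcut : ¬ HasOddCutLE G (k + 1))
    (e : Fin k → Sym2 V) (he : ∀ j, e j ∈ G.edgeSet)
    (a b : V) (hab : G.Adj a b)
    (x : V) (H : G.Walk x x) (hH : H.IsCircuit) (hHe : ∀ j, e j ∈ H.edges)
    (hbr : (G.deleteEdges {f | f ∈ H.edges}).IsBridge s(a, b)) :
    ∃ (y : V) (c : G.Walk y y), c.IsCircuit ∧ (∀ j, e j ∈ c.edges) ∧
      s(a, b) ∈ c.edges ∧
      (a ∉ H.support → c.support.tail.count a = 1) ∧
      (b ∉ H.support → c.support.tail.count b = 1) := by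
  by_cases habH : s(a, b) ∈ H.edges
  · exact ⟨x, H, hH, hHe, habH,
      fun h => absurd (H.fst_mem_support_of_mem_edges habH) h,
      fun h => absurd (H.snd_mem_support_of_mem_edges habH) h⟩
  rw [isBridge_iff, deleteEdges_deleteEdges] at hbr
  have hMk : ∀ L : List (Sym2 V), L.Nodup → (∀ m ∈ L, m ∈ Set.range e) → L.length ≤ k := by
    intro L hL hm
    have h1 : L.toFinset ⊆ Finset.univ.image e := by
      intro m h
      obtain ⟨j, rfl⟩ := hm m (List.mem_toFinset.1 h)
      simp
    have h2 := Finset.card_le_card h1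
    rw [List.toFinset_card_of_nodup hL] at h2
    have h3 := Finset.card_image_le (s := Finset.univ) (f := e)
    simp at h3
    omega
  have main : ∀ (x' : V) (H' : G.Walk x' x'), H'.IsTrail → (∀ f, f ∈ H'.edges ↔ f ∈ H.edges) →
      (∀ v, v ∈ H'.support ↔ v ∈ H.support) →
      (k = 0 ∨ ∃ h : 0 < H'.edges.length, H'.edges[0] ∈ Set.range e) →
      ∃ (y : V) (c : G.Walk y y), c.IsCircuit ∧ (∀ j, e j ∈ c.edges) ∧
      s(a, b) ∈ c.edges ∧
      (a ∉ H.support → c.support.tail.count a = 1) ∧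
      (b ∉ H.support → c.support.tail.count b = 1) := by
    intro x' H' h1 h2 h3 h4
    have h5 : {f | f ∈ H'.edges} = {f | f ∈ H.edges} := Set.ext h2
    obtain ⟨y, c, c1, c2, c3, c4, c5⟩ := hop_main k hcut hMk hab H' h1
      (by rintro m ⟨j, rfl⟩; exact (h2 _).2 (hHe j)) h4 (by rwa [h2]) (by rwa [h5])
    exact ⟨y, c, c1, fun j => c2 _ ⟨j, rfl⟩, c3, by rwa [h3] at c4, by rwa [h3] at c5⟩
  rcases Nat.eq_zero_or_pos k with h0 | h0
  · exact main x H hH.isTrail (fun _ => Iff.rfl) (fun _ => Iff.rfl) (Or.inl h0)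
  · -- rotate so that the first edge is prescribed
    have hm := hHe ⟨0, h0⟩
    obtain ⟨i, hi, hie⟩ := List.mem_iff_getElem.1 hm
    have hE : ((H.drop i).append (H.take i)).edges = H.edges.drop i ++ H.edges.take i := by
      rw [Walk.edges_append, Walk.edges_drop, Walk.edges_take]
    have hperm : (H.edges.drop i ++ H.edges.take i).Perm H.edges := by
      have := List.perm_append_comm (l₁ := H.edges.drop i) (l₂ := H.edges.take i)
      rwa [List.take_append_drop] at this
    refine main _ ((H.drop i).append (H.take i)) ?_ ?_ ?_ (Or.inr ?_)
    · rw [Walk.isTrail_def, hE]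
      exact hperm.nodup_iff.2 hH.isTrail.edges_nodup
    · intro f
      rw [hE]; exact hperm.mem_iff
    · intro v
      rw [Walk.mem_support_append_iff, or_comm, ← Walk.mem_support_append_iff, H.append_take_drop_eq]
    · refine ⟨by rw [hE, hperm.length_eq]; omega, ⟨0, h0⟩, ?_⟩
      simp only [hE]
      rw [List.getElem_append_left (by simp; simpa using hi)]
      simp [hie]
end
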